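/- arXiv:1707.08942 — 2 statements merged into one kernel-verified Lean document; each statement's English description precedes it below -/
import Mathlib

section
/- For all a > 0 and b > 0, ∫_0^∞ (x J₀(a x)/(x² + b²)) dx = K₀(a b). -/
open MeasureTheory Filter Set

/-- The Bessel function of the first kind of order zero. -/
noncomputable def besselJ0 (y : ℝ) : ℝ :=
  ∑' n : ℕ, (-1) ^ n * (y / 2) ^ (2 * n) / ((n.factorial : ℝ)) ^ 2

/-- The Bessel–Clifford type series `∑ (-1)ⁿ zⁿ / (n! (n+k)!)`. -/
noncomputable def besselClifford (k : ℕ) (z : ℝ) : ℝ :=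
  ∑' n : ℕ, (-1) ^ n * z ^ n / ((n.factorial : ℝ) * ((n + k).factorial : ℝ))

lemma norm_besselClifford_term_le (k n : ℕ) (z : ℝ) :
    ‖(-1) ^ n * z ^ n / ((n.factorial : ℝ) * ((n + k).factorial : ℝ))‖ ≤
      |z| ^ n / (n.factorial : ℝ) := by
  have h1 : (1 : ℝ) ≤ ((n + k).factorial : ℝ) := by exact_mod_cast Nat.factorial_pos _
  have h2 : (0 : ℝ) < (n.factorial : ℝ) := by positivity
  rw [norm_div, norm_mul, norm_pow, norm_pow, norm_neg, norm_one, one_pow, one_mul,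
    Real.norm_eq_abs, Real.norm_of_nonneg (by positivity)]
  gcongr
  nlinarith

lemma summable_besselClifford (k : ℕ) (z : ℝ) :
    Summable fun n : ℕ => (-1) ^ n * z ^ n / ((n.factorial : ℝ) * ((n + k).factorial : ℝ)) :=
  .of_norm_bounded (Real.summable_pow_div_factorial |z|)
    fun n => norm_besselClifford_term_le k n z

lemma hasDerivAt_besselClifford (k : ℕ) (z : ℝ) :
    HasDerivAt (besselClifford k) (-besselClifford (k + 1) z) z := by
  set R := |z| + 1
  have hR : 0 < R := by positivity
  have hz : z ∈ Metric.ball (0 : ℝ) R := by simp [R]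
  have hu : Summable fun n : ℕ => (n : ℝ) * R ^ (n - 1) / (n.factorial : ℝ) := by
    rw [← summable_nat_add_iff 1]
    refine (Real.summable_pow_div_factorial R).congr fun n => ?_
    rw [Nat.factorial_succ]
    push_cast
    have : (n : ℝ) + 1 ≠ 0 := by positivity
    field_simp
  have hbound : ∀ (n : ℕ), ∀ y ∈ Metric.ball (0 : ℝ) R,
      ‖(-1) ^ n * (n * y ^ (n - 1)) / ((n.factorial : ℝ) * ((n + k).factorial : ℝ))‖ ≤
        (n : ℝ) * R ^ (n - 1) / (n.factorial : ℝ) := by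
    intro n y hy
    have hy' : |y| ≤ R := by simpa using (mem_ball_zero_iff.1 hy).le
    have h1 : (1 : ℝ) ≤ ((n + k).factorial : ℝ) := by exact_mod_cast Nat.factorial_pos _
    have h2 : (0 : ℝ) < (n.factorial : ℝ) := by positivity
    rw [norm_div, norm_mul, norm_mul, norm_pow, norm_pow, norm_neg, norm_one, one_pow, one_mul,
      Real.norm_eq_abs y, Real.norm_of_nonneg (by positivity : (0 : ℝ) ≤ (n : ℝ)),
      Real.norm_of_nonneg (by positivity)]
    gcongr
    nlinarith
  have key := hasDerivAt_tsum_of_isPreconnected hu Metric.isOpen_ball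
    (convex_ball (0 : ℝ) R).isPreconnected
    (fun n y _ => (((hasDerivAt_pow n y).const_mul ((-1 : ℝ) ^ n)).div_const
      ((n.factorial : ℝ) * ((n + k).factorial : ℝ)))) hbound hz (summable_besselClifford k z) hz
  have hsum := Summable.of_norm_bounded hu fun n => hbound n z hz
  refine HasDerivAt.congr_deriv key ?_
  rw [hsum.tsum_eq_zero_add, besselClifford, ← tsum_neg]
  simp only [Nat.cast_zero, zero_mul, mul_zero, zero_div, zero_add]
  refine tsum_congr fun n => ?_
  rw [Nat.factorial_succ, show n + 1 + k = n + (k + 1) by ring]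
  push_cast
  have : (n : ℝ) + 1 ≠ 0 := by positivity
  field_simp
  ring

lemma besselClifford_recurrence (z : ℝ) :
    besselClifford 0 z - besselClifford 1 z + z * besselClifford 2 z = 0 := by
  have h := ((summable_besselClifford 0 z).sub (summable_besselClifford 1 z))
  have e : besselClifford 0 z - besselClifford 1 z = -(z * besselClifford 2 z) := by
    simp only [besselClifford]
    rw [← (summable_besselClifford 0 z).tsum_sub (summable_besselClifford 1 z),
      h.tsum_eq_zero_add, ← tsum_mul_left, ← tsum_neg]
    simp only [Nat.factorial_zero, zero_add, Nat.factorial_one, pow_zero, sub_self]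
    refine tsum_congr fun n => ?_
    rw [show n + 1 + 1 = n + 2 by ring, show n + 1 + 0 = n + 1 by ring,
      Nat.factorial_succ (n + 1), Nat.factorial_succ n]
    push_cast
    have : (n : ℝ) + 1 ≠ 0 := by positivity
    have : (n : ℝ) + 1 + 1 ≠ 0 := by positivity
    field_simp
    ring
  rw [e]; ring

lemma besselJ0_eq_besselClifford (y : ℝ) : besselJ0 y = besselClifford 0 (y ^ 2 / 4) := by
  simp only [besselJ0, besselClifford]
  refine tsum_congr fun n => ?_
  rw [pow_mul, add_zero, sq (n.factorial : ℝ), div_pow]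
  norm_num

/-- The derivative of `besselJ0`. -/
noncomputable def besselJ0Deriv (y : ℝ) : ℝ := -(y / 2) * besselClifford 1 (y ^ 2 / 4)

lemma hasDerivAt_besselJ0 (y : ℝ) : HasDerivAt besselJ0 (besselJ0Deriv y) y := by
  have h : HasDerivAt (fun y : ℝ => y ^ 2 / 4) (y / 2) y := by
    refine ((hasDerivAt_pow 2 y).div_const 4).congr_deriv ?_
    push_cast
    ring
  rw [funext besselJ0_eq_besselClifford]
  refine ((hasDerivAt_besselClifford 0 (y ^ 2 / 4)).comp y h).congr_deriv ?_
  rw [besselJ0Deriv]; ring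

lemma hasDerivAt_besselJ0Deriv {y : ℝ} (hy : y ≠ 0) :
    HasDerivAt besselJ0Deriv (-besselJ0Deriv y / y - besselJ0 y) y := by
  have h : HasDerivAt (fun y : ℝ => y ^ 2 / 4) (y / 2) y := by
    refine ((hasDerivAt_pow 2 y).div_const 4).congr_deriv ?_
    push_cast
    ring
  have h2 := ((hasDerivAt_id y).div_const 2).neg.mul
    ((hasDerivAt_besselClifford 1 (y ^ 2 / 4)).comp y h)
  refine HasDerivAt.congr_deriv (f' := _) h2 ?_
  have := besselClifford_recurrence (y ^ 2 / 4)
  rw [besselJ0Deriv, besselJ0_eq_besselClifford]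
  simp only [Function.comp_apply, Pi.neg_apply, id, Nat.reduceAdd]
  field_simp
  linear_combination 4 * this

lemma continuous_besselJ0 : Continuous besselJ0 :=
  continuous_iff_continuousAt.2 fun y => (hasDerivAt_besselJ0 y).continuousAt

/-- The Bessel equation makes the energy of `√y J₀(y)` nonincreasing, whence
 `J₀(y) = O(y^{-1/2})`. -/
lemma exists_mul_sq_besselJ0_le :
    ∃ C : ℝ, ∀ y : ℝ, 1 ≤ y → y * besselJ0 y ^ 2 ≤ C := by
  let E : ℝ → ℝ := fun y => y * besselJ0Deriv y ^ 2 + besselJ0 y * besselJ0Deriv y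
    + y * besselJ0 y ^ 2 + besselJ0 y ^ 2 / (2 * y)
  have hE : ∀ y : ℝ, 0 < y → HasDerivAt E (-besselJ0 y ^ 2 / (2 * y ^ 2)) y := by
    intro y hy
    have h0 := hasDerivAt_besselJ0 y
    have h1 := hasDerivAt_besselJ0Deriv hy.ne'
    have hid := hasDerivAt_id y
    have := (((hid.mul (h1.pow 2)).add (h0.mul h1)).add (hid.mul (h0.pow 2))).add
      ((h0.pow 2).div (hid.const_mul 2) (by simpa using hy.ne'))
    refine HasDerivAt.congr_deriv this ?_
    simp only [id, Pi.pow_apply]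
    field_simp
    ring
  have hanti : AntitoneOn E (Ici 1) := by
    refine antitoneOn_of_deriv_nonpos (convex_Ici 1) ?_ ?_ ?_
    · exact fun y hy => (hE y (zero_lt_one.trans_le hy)).continuousAt.continuousWithinAt
    · intro y hy
      rw [interior_Ici] at hy
      exact (hE y (zero_lt_one.trans hy)).differentiableAt.differentiableWithinAt
    · intro y hy
      rw [interior_Ici] at hy
      rw [(hE y (zero_lt_one.trans hy)).deriv, neg_div]
      exact neg_nonpos.2 (by positivity)
  refine ⟨E 1, fun y hy => le_trans ?_ (hanti (mem_Ici.2 le_rfl) hy hy)⟩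
  have hy0 : 0 < y := zero_lt_one.trans_le hy
  have : E y - y * besselJ0 y ^ 2
      = ((y * besselJ0Deriv y + besselJ0 y / 2) ^ 2 + besselJ0 y ^ 2 / 4) / y := by
    simp only [E]
    field_simp
    ring
  have h2 : 0 ≤ E y - y * besselJ0 y ^ 2 := by rw [this]; positivity
  linarith

lemma integrableOn_mul_besselJ0_div {a b : ℝ} (ha : 0 < a) (hb : 0 < b) :
    IntegrableOn (fun x => x * besselJ0 (a * x) / (x ^ 2 + b ^ 2)) (Ioi (0 : ℝ)) := by
  obtain ⟨C, hC⟩ := exists_mul_sq_besselJ0_le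
  have hcont : Continuous fun x => x * besselJ0 (a * x) / (x ^ 2 + b ^ 2) :=
    (continuous_id.mul (continuous_besselJ0.comp (continuous_const_mul a))).div
      (by fun_prop) fun x => by positivity
  have ha' : 0 < 1 / a := by positivity
  rw [← Ioc_union_Ioi_eq_Ioi ha'.le]
  refine IntegrableOn.union ?_ ?_
  · exact (hcont.integrableOn_Icc).mono_set Ioc_subset_Icc_self
  · refine Integrable.mono' ((integrableOn_Ioi_rpow_of_lt
      (by norm_num : (-(3 / 2) : ℝ) < -1) ha').const_mul (√(C / a)))
      hcont.aestronglyMeasurable ?_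
    refine (ae_restrict_iff' measurableSet_Ioi).2 (ae_of_all _ fun x hx => ?_)
    have hx0 : 0 < x := ha'.trans hx
    have hax : 1 ≤ a * x := by
      have := (div_lt_iff₀ ha).1 (mem_Ioi.1 hx)
      linarith
    have hJ : |besselJ0 (a * x)| ≤ √(C / a) / √x := by
      rw [← Real.sqrt_div' _ hx0.le]
      refine Real.abs_le_sqrt ?_
      rw [div_div, le_div_iff₀ (by positivity)]
      linarith [hC _ hax]
    have hpow : x ^ (-(3 / 2) : ℝ) = 1 / (x * √x) := by
      rw [Real.rpow_neg hx0.le, Real.sqrt_eq_rpow, ← Real.rpow_one_add' hx0.le (by norm_num),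
        one_div]
      norm_num
    rw [hpow, norm_div, norm_mul, Real.norm_of_nonneg hx0.le, Real.norm_eq_abs,
      Real.norm_of_nonneg (by positivity : 0 ≤ x ^ 2 + b ^ 2)]
    calc x * |besselJ0 (a * x)| / (x ^ 2 + b ^ 2)
        ≤ x * (√(C / a) / √x) / x ^ 2 := by
          gcongr
          nlinarith [sq_nonneg b]
      _ = √(C / a) * (1 / (x * √x)) := by
          have : 0 < √x := Real.sqrt_pos.2 hx0
          field_simp

lemma integrableOn_pow_mul_exp_neg_mul_sq {s : ℝ} (hs : 0 < s) (n : ℕ) :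
    IntegrableOn (fun x => x ^ n * Real.exp (-s * x ^ 2)) (Ioi (0 : ℝ)) := by
  have := integrableOn_rpow_mul_exp_neg_mul_sq hs (s := n)
    (by linarith [(Nat.cast_nonneg n : (0 : ℝ) ≤ n)])
  simpa only [Real.rpow_natCast] using this

lemma integral_pow_odd_mul_exp_neg_mul_sq {s : ℝ} (hs : 0 < s) (n : ℕ) :
    ∫ x in Ioi (0 : ℝ), x ^ (2 * n + 1) * Real.exp (-s * x ^ 2) =
      n.factorial / (2 * s ^ (n + 1)) := by
  have h := integral_rpow_mul_exp_neg_mul_rpow (p := 2) (q := (2 * n + 1 : ℕ)) two_pos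
    (by linarith [(Nat.cast_nonneg (2 * n + 1) : (0 : ℝ) ≤ (2 * n + 1 : ℕ))]) hs
  have e1 : (((2 * n + 1 : ℕ) : ℝ) + 1) / 2 = n + 1 := by push_cast; ring
  rw [neg_div, e1, Real.Gamma_nat_eq_factorial, Real.rpow_neg hs.le] at h
  simp only [Real.rpow_natCast, Real.rpow_two] at h
  rw [h, ← Nat.cast_add_one, Real.rpow_natCast]
  field_simp

lemma integral_mul_besselJ0_mul_exp_neg_mul_sq (a : ℝ) {s : ℝ} (hs : 0 < s) :
    ∫ x in Ioi (0 : ℝ), x * besselJ0 (a * x) * Real.exp (-s * x ^ 2) =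
      Real.exp (-(a ^ 2 / (4 * s))) / (2 * s) := by
  let G : ℕ → ℝ → ℝ := fun n x =>
    (a / 2) ^ (2 * n) / (n.factorial : ℝ) ^ 2 * (x ^ (2 * n + 1) * Real.exp (-s * x ^ 2))
  have hG : ∀ n, IntegrableOn (G n) (Ioi 0) := fun n =>
    (integrableOn_pow_mul_exp_neg_mul_sq hs (2 * n + 1)).const_mul _
  have hG0 : ∀ n, ∀ x : ℝ, 0 < x → 0 ≤ G n x := by
    intro n x hx
    have : 0 ≤ (a / 2) ^ (2 * n) := by rw [pow_mul]; positivity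
    simp only [G]
    positivity
  have hGint : ∀ n, ∫ x in Ioi (0 : ℝ), G n x =
      (a ^ 2 / (4 * s)) ^ n / n.factorial * (1 / (2 * s)) := by
    intro n
    have h4 : a ^ 2 / (4 * s) = (a / 2) ^ 2 / s := by field_simp; norm_num
    simp only [G]
    rw [integral_const_mul, integral_pow_odd_mul_exp_neg_mul_sq hs, h4, pow_mul, div_pow _ s,
      pow_succ s]
    have : (n.factorial : ℝ) ≠ 0 := by positivity
    field_simp
  have h_int : ∀ n, ∫ x in Ioi (0 : ℝ), (-1) ^ n * G n x =
      (-(a ^ 2 / (4 * s))) ^ n / n.factorial * (1 / (2 * s)) := by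
    intro n
    rw [integral_const_mul, hGint, neg_pow (a ^ 2 / (4 * s))]
    ring
  have hnorm : ∀ n, ∫ x in Ioi (0 : ℝ), ‖(-1) ^ n * G n x‖ =
      (a ^ 2 / (4 * s)) ^ n / n.factorial * (1 / (2 * s)) := by
    intro n
    rw [← hGint]
    refine setIntegral_congr_fun measurableSet_Ioi fun x hx => ?_
    rw [norm_mul, norm_pow, norm_neg, norm_one, one_pow, one_mul,
      Real.norm_of_nonneg (hG0 n x hx)]
  have hsumm : Summable fun n => ∫ x in Ioi (0 : ℝ), ‖(-1) ^ n * G n x‖ := by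
    simp only [hnorm]
    exact (Real.summable_pow_div_factorial _).mul_right _
  have key := hasSum_integral_of_summable_integral_norm
    (fun n => (hG n).const_mul ((-1) ^ n)) hsumm
  have hexp : HasSum (fun n => ∫ x in Ioi (0 : ℝ), (-1) ^ n * G n x)
      (Real.exp (-(a ^ 2 / (4 * s))) * (1 / (2 * s))) := by
    have h := NormedSpace.expSeries_div_hasSum_exp (-(a ^ 2 / (4 * s)))
    rw [← Real.exp_eq_exp_ℝ] at h
    simpa only [h_int] using h.mul_right (1 / (2 * s))
  rw [div_eq_mul_one_div, ← key.unique hexp]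
  congr 1
  ext x
  rw [besselJ0, ← tsum_mul_left, ← tsum_mul_right]
  refine tsum_congr fun n => ?_
  simp only [G]
  rw [mul_div_right_comm a x 2, mul_pow]
  ring

lemma integral_exp_neg_mul_Ioi_zero {c : ℝ} (hc : 0 < c) :
    ∫ s in Ioi (0 : ℝ), Real.exp (-c * s) = 1 / c := by
  rw [integral_exp_mul_Ioi (neg_lt_zero.2 hc)]
  simp

lemma integral_mul_besselJ0_div {a b : ℝ} (ha : 0 < a) (hb : 0 < b) :
    ∫ x in Ioi (0 : ℝ), x * besselJ0 (a * x) / (x ^ 2 + b ^ 2) =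
      ∫ s in Ioi (0 : ℝ),
        Real.exp (-(b ^ 2 * s)) * (Real.exp (-(a ^ 2 / (4 * s))) / (2 * s)) := by
  let f : ℝ → ℝ → ℝ := fun x s => x * besselJ0 (a * x) * Real.exp (-(x ^ 2 + b ^ 2) * s)
  have hcont : Continuous (Function.uncurry f) := by
    have := continuous_besselJ0
    simp only [f, Function.uncurry_def]
    fun_prop
  have hx : ∀ x : ℝ, 0 < x ^ 2 + b ^ 2 := fun x => by positivity
  have hf : Integrable (Function.uncurry f)
      ((volume.restrict (Ioi 0)).prod (volume.restrict (Ioi 0))) := by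
    refine (integrable_prod_iff hcont.aestronglyMeasurable).2 ⟨ae_of_all _ fun x => ?_, ?_⟩
    · exact (integrableOn_exp_mul_Ioi (neg_lt_zero.2 (hx x)) 0).const_mul (x * besselJ0 (a * x))
    · refine (integrableOn_mul_besselJ0_div ha hb).norm.congr (ae_of_all _ fun x => ?_)
      simp only [Function.uncurry_apply_pair, f, norm_mul, norm_div, Real.norm_eq_abs,
        Real.abs_exp]
      rw [integral_const_mul, integral_exp_neg_mul_Ioi_zero (hx x), abs_of_pos (hx x)]
      ring
  calc ∫ x in Ioi (0 : ℝ), x * besselJ0 (a * x) / (x ^ 2 + b ^ 2)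
      = ∫ x in Ioi (0 : ℝ), ∫ s in Ioi (0 : ℝ), f x s := by
        congr 1
        ext x
        simp only [f]
        rw [integral_const_mul, integral_exp_neg_mul_Ioi_zero (hx x)]
        ring
    _ = ∫ s in Ioi (0 : ℝ), ∫ x in Ioi (0 : ℝ), f x s := integral_integral_swap hf
    _ = _ := by
        refine setIntegral_congr_fun measurableSet_Ioi fun s hs => ?_
        rw [← integral_mul_besselJ0_mul_exp_neg_mul_sq a hs, ← integral_const_mul]
        congr 1
        ext x
        simp only [f]
        rw [mul_left_comm, ← Real.exp_add]
        ring_nf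

lemma integral_cos_mul_exp_neg_mul_sq (x : ℝ) {u : ℝ} (hu : 0 < u) :
    ∫ t in Ioi (0 : ℝ), Real.cos (x * t) * Real.exp (-u * t ^ 2) =
      √(Real.pi / u) / 2 * Real.exp (-(x ^ 2 / (4 * u))) := by
  have h1 : ∫ t : ℝ, Real.cos (x * t) * Real.exp (-u * t ^ 2) =
      √(Real.pi / u) * Real.exp (-(x ^ 2 / (4 * u))) := by
    have h := fourierIntegral_gaussian (b := u) (by simpa using hu) x
    have h_int : Integrable fun t : ℝ =>
        Complex.exp (Complex.I * x * t) * Complex.exp (-(u : ℂ) * t ^ 2) := by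
      refine (integrable_exp_neg_mul_sq hu).mono' (by fun_prop) (ae_of_all _ fun t => ?_)
      rw [norm_mul, Complex.norm_exp, Complex.norm_exp]
      simp [← Complex.ofReal_pow]
    have hre := integral_re h_int
    rw [h] at hre
    have e : ((Real.pi / u : ℂ)) ^ (1 / 2 : ℂ) * Complex.exp (-(x : ℂ) ^ 2 / (4 * u)) =
        ((√(Real.pi / u) * Real.exp (-(x ^ 2 / (4 * u))) : ℝ) : ℂ) := by
      rw [Real.sqrt_eq_rpow]
      push_cast
      rw [Complex.ofReal_cpow (by positivity)]
      push_cast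
      rw [neg_div]
    rw [e] at hre
    refine Eq.trans ?_ (hre.trans (Complex.ofReal_re _))
    congr 1
    ext t
    have e2 : Complex.exp (-(u : ℂ) * t ^ 2) = ((Real.exp (-u * t ^ 2) : ℝ) : ℂ) := by
      push_cast; rfl
    have e3 : Complex.I * x * t = ((x * t : ℝ) : ℂ) * Complex.I := by push_cast; ring
    rw [e2, e3]
    simp [Complex.exp_ofReal_mul_I_re, -Complex.ofReal_mul, -Complex.ofReal_exp]
  have h2 := integral_comp_abs (f := fun t => Real.cos (x * t) * Real.exp (-u * t ^ 2))
  have h3 : ∀ t : ℝ, Real.cos (x * |t|) * Real.exp (-u * |t| ^ 2) =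
      Real.cos (x * t) * Real.exp (-u * t ^ 2) := by
    intro t
    rw [sq_abs]
    rcases abs_choice t with h | h <;> rw [h]
    rw [mul_neg, Real.cos_neg]
  simp only [h3, h1] at h2
  linarith

lemma abs_intervalIntegral_cos_mul_exp_neg_mul_sq_le {x u T : ℝ} (hx : 0 < x) (hu : 0 < u)
    (hT : 0 ≤ T) :
    |∫ t in (0 : ℝ)..T, Real.cos (x * t) * Real.exp (-u * t ^ 2)| ≤ 2 / x := by
  have hg : ∀ t : ℝ, HasDerivAt (fun t => Real.exp (-u * t ^ 2))
      (-(2 * u * t * Real.exp (-u * t ^ 2))) t := by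
    intro t
    refine (((hasDerivAt_pow 2 t).const_mul (-u)).exp).congr_deriv ?_
    push_cast
    ring
  have hs : ∀ t : ℝ, HasDerivAt (fun t => Real.sin (x * t) / x) (Real.cos (x * t)) t := by
    intro t
    refine ((((hasDerivAt_id t).const_mul x).sin).div_const x).congr_deriv ?_
    simp only [id]
    field_simp
  have hparts := intervalIntegral.integral_mul_deriv_eq_deriv_mul (a := 0) (b := T)
    (fun t _ => hg t) (fun t _ => hs t)
    (Continuous.intervalIntegrable (by fun_prop) _ _)
    (Continuous.intervalIntegrable (by fun_prop) _ _)
  have hderiv : ∫ t in (0 : ℝ)..T, 2 * u * t * Real.exp (-u * t ^ 2) =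
      1 - Real.exp (-u * T ^ 2) := by
    rw [intervalIntegral.integral_eq_sub_of_hasDerivAt
      (f := fun t => -Real.exp (-u * t ^ 2)) (fun t _ => (hg t).neg.congr_deriv (neg_neg _))
      (Continuous.intervalIntegrable (by fun_prop) _ _)]
    simp
    ring
  have hsin : ∀ t : ℝ, |Real.sin (x * t) / x| ≤ 1 / x := by
    intro t
    rw [abs_div, abs_of_pos hx]
    gcongr
    exact Real.abs_sin_le_one _
  have hrest : |∫ t in (0 : ℝ)..T,
      -(2 * u * t * Real.exp (-u * t ^ 2)) * (Real.sin (x * t) / x)| ≤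
        (1 - Real.exp (-u * T ^ 2)) * (1 / x) := by
    have hcont : Continuous fun t : ℝ => 2 * u * t * Real.exp (-u * t ^ 2) * (1 / x) := by
      fun_prop
    rw [← hderiv, ← intervalIntegral.integral_mul_const, ← Real.norm_eq_abs]
    refine intervalIntegral.norm_integral_le_of_norm_le hT (ae_of_all _ fun t ht => ?_)
      (hcont.intervalIntegrable 0 T)
    have ht0 : 0 < t := ht.1
    rw [norm_mul, norm_neg, Real.norm_of_nonneg (by positivity)]
    gcongr
    exact hsin t
  have hend : |Real.exp (-u * T ^ 2) * (Real.sin (x * T) / x)| ≤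
      Real.exp (-u * T ^ 2) * (1 / x) := by
    rw [abs_mul, Real.abs_exp]
    gcongr
    exact hsin T
  simp only [mul_comm (Real.cos _)]
  rw [hparts]
  simp only [mul_zero, Real.sin_zero, zero_div, sub_zero]
  calc _ ≤ _ := abs_sub _ _
    _ ≤ _ := add_le_add hend hrest
    _ = 1 / x := by ring
    _ ≤ 2 / x := by gcongr; norm_num

/-- The density in `1 / √(t² + 1) = ∫₀^∞ w(u) exp(-u t²) du`. -/
noncomputable def invSqrtWeight (u : ℝ) : ℝ :=
  1 / √Real.pi * (u ^ (1 / 2 - 1 : ℝ) * Real.exp (-u))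

lemma invSqrtWeight_nonneg {u : ℝ} (hu : 0 < u) : 0 ≤ invSqrtWeight u := by
  rw [invSqrtWeight]; positivity

lemma integrableOn_invSqrtWeight : IntegrableOn invSqrtWeight (Ioi 0) := by
  have := (Real.GammaIntegral_convergent (s := 1 / 2) (by norm_num)).const_mul (1 / √Real.pi)
  refine this.congr (ae_of_all _ fun u => ?_)
  beta_reduce
  rw [invSqrtWeight, mul_comm (Real.exp _)]

lemma integral_invSqrtWeight_mul_exp (t : ℝ) :
    ∫ u in Ioi (0 : ℝ), invSqrtWeight u * Real.exp (-u * t ^ 2) = 1 / √(t ^ 2 + 1) := by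
  have hr : 0 < t ^ 2 + 1 := by positivity
  have h := Real.integral_rpow_mul_exp_neg_mul_Ioi (a := 1 / 2) (by norm_num) hr
  have hpi : √Real.pi ≠ 0 := (Real.sqrt_pos.2 Real.pi_pos).ne'
  calc ∫ u in Ioi (0 : ℝ), invSqrtWeight u * Real.exp (-u * t ^ 2)
      = ∫ u in Ioi (0 : ℝ),
          1 / √Real.pi * (u ^ (1 / 2 - 1 : ℝ) * Real.exp (-((t ^ 2 + 1) * u))) := by
        congr 1
        ext u
        rw [invSqrtWeight, mul_assoc, mul_assoc, ← Real.exp_add]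
        ring_nf
    _ = 1 / √(t ^ 2 + 1) := by
        rw [integral_const_mul, h, Real.Gamma_one_half_eq, ← Real.sqrt_eq_rpow,
          Real.sqrt_div zero_le_one, Real.sqrt_one]
        field_simp

lemma integrable_invSqrtWeight_mul_cos (x T : ℝ) :
    Integrable (fun p : ℝ × ℝ =>
        invSqrtWeight p.2 * (Real.cos (x * p.1) * Real.exp (-p.2 * p.1 ^ 2)))
      ((volume.restrict (Ioc 0 T)).prod (volume.restrict (Ioi 0))) := by
  have hw : Integrable (fun p : ℝ × ℝ => (1 : ℝ) * invSqrtWeight p.2)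
      ((volume.restrict (Ioc 0 T)).prod (volume.restrict (Ioi 0))) :=
    (integrable_const (1 : ℝ)).mul_prod integrableOn_invSqrtWeight
  simp only [one_mul] at hw
  rw [Measure.prod_restrict] at hw ⊢
  refine hw.norm.mono' (hw.aestronglyMeasurable.mul (by fun_prop)) ?_
  refine (ae_restrict_iff' (measurableSet_Ioc.prod measurableSet_Ioi)).2
    (ae_of_all _ fun p hp => ?_)
  have hp2 : 0 < p.2 := hp.2
  rw [norm_mul]
  refine mul_le_of_le_one_right (norm_nonneg _) ?_
  rw [norm_mul, Real.norm_eq_abs, Real.norm_eq_abs, Real.abs_exp]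
  refine mul_le_one₀ (Real.abs_cos_le_one _) (Real.exp_pos _).le (Real.exp_le_one_iff.2 ?_)
  nlinarith [mul_nonneg hp2.le (sq_nonneg p.1)]

lemma intervalIntegral_cos_div_sqrt (x : ℝ) {T : ℝ} (hT : 0 ≤ T) :
    ∫ t in (0 : ℝ)..T, Real.cos (x * t) / √(t ^ 2 + 1) =
      ∫ u in Ioi (0 : ℝ), invSqrtWeight u *
        ∫ t in (0 : ℝ)..T, Real.cos (x * t) * Real.exp (-u * t ^ 2) := by
  simp only [intervalIntegral.integral_of_le hT, ← integral_const_mul]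
  rw [← integral_integral_swap (integrable_invSqrtWeight_mul_cos x T)]
  congr 1
  ext t
  rw [div_eq_mul_one_div, ← integral_invSqrtWeight_mul_exp, ← integral_const_mul]
  congr 1
  ext u
  ring

lemma tendsto_intervalIntegral_cos_div_sqrt {x : ℝ} (hx : 0 < x) :
    Tendsto (fun T => ∫ t in (0 : ℝ)..T, Real.cos (x * t) / √(t ^ 2 + 1)) atTop
      (nhds (∫ u in Ioi (0 : ℝ), Real.exp (-u) * (Real.exp (-(x ^ 2 / (4 * u))) / (2 * u)))) := by
  have hlim : Tendsto (fun T => ∫ u in Ioi (0 : ℝ), invSqrtWeight u *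
        ∫ t in (0 : ℝ)..T, Real.cos (x * t) * Real.exp (-u * t ^ 2)) atTop
      (nhds (∫ u in Ioi (0 : ℝ), Real.exp (-u) *
        (Real.exp (-(x ^ 2 / (4 * u))) / (2 * u)))) := by
    refine tendsto_integral_filter_of_dominated_convergence
      (fun u => invSqrtWeight u * (2 / x)) ?_ ?_ (integrableOn_invSqrtWeight.mul_const _) ?_
    · filter_upwards [eventually_ge_atTop 0] with T hT
      simp only [intervalIntegral.integral_of_le hT, ← integral_const_mul]
      exact (integrable_invSqrtWeight_mul_cos x T).integral_prod_right.aestronglyMeasurable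
    · filter_upwards [eventually_ge_atTop 0] with T hT
      refine (ae_restrict_iff' measurableSet_Ioi).2 (ae_of_all _ fun u hu => ?_)
      have := invSqrtWeight_nonneg hu
      rw [norm_mul, Real.norm_of_nonneg this]
      gcongr
      exact abs_intervalIntegral_cos_mul_exp_neg_mul_sq_le hx hu hT
    · refine (ae_restrict_iff' measurableSet_Ioi).2 (ae_of_all _ fun u hu => ?_)
      have hu0 : 0 < u := hu
      have h_int : IntegrableOn (fun t => Real.cos (x * t) * Real.exp (-u * t ^ 2)) (Ioi 0) := by
        refine ((integrable_exp_neg_mul_sq hu0).mono' (by fun_prop)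
          (ae_of_all _ fun t => ?_)).integrableOn
        rw [norm_mul, Real.norm_eq_abs, Real.norm_of_nonneg (Real.exp_pos _).le]
        exact mul_le_of_le_one_left (Real.exp_pos _).le (Real.abs_cos_le_one _)
      have h := (intervalIntegral_tendsto_integral_Ioi 0 h_int tendsto_id).const_mul
        (invSqrtWeight u)
      rw [integral_cos_mul_exp_neg_mul_sq x hu0] at h
      have e : invSqrtWeight u * (√(Real.pi / u) / 2 * Real.exp (-(x ^ 2 / (4 * u)))) =
          Real.exp (-u) * (Real.exp (-(x ^ 2 / (4 * u))) / (2 * u)) := by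
        have hpow : u ^ (1 / 2 - 1 : ℝ) = 1 / √u := by
          rw [Real.sqrt_eq_rpow, one_div (u ^ _), ← Real.rpow_neg hu0.le]
          norm_num
        have hpi : 0 < √Real.pi := Real.sqrt_pos.2 Real.pi_pos
        have hsu : 0 < √u := Real.sqrt_pos.2 hu0
        rw [invSqrtWeight, hpow, Real.sqrt_div Real.pi_pos.le]
        field_simp
        rw [Real.sq_sqrt hu0.le]
      rwa [e] at h
  refine hlim.congr' ?_
  filter_upwards [eventually_ge_atTop 0] with T hT
  exact (intervalIntegral_cos_div_sqrt x hT).symm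

theorem stmt_15 (K0 : ℝ → ℝ)
    (hK0 : ∀ x ∈ Ioi (0:ℝ),
      Tendsto (fun T => ∫ t in (0:ℝ)..T, Real.cos (x * t) / Real.sqrt (t ^ 2 + 1))
        atTop (nhds (K0 x)))
    (a b : ℝ) (ha : 0 < a) (hb : 0 < b) :
    ∫ x in Ioi (0:ℝ), x * besselJ0 (a * x) / (x ^ 2 + b ^ 2) = K0 (a * b) := by
  have hab : 0 < a * b := mul_pos ha hb
  rw [tendsto_nhds_unique (hK0 (a * b) hab) (tendsto_intervalIntegral_cos_div_sqrt hab),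
    integral_mul_besselJ0_div ha hb]
  have hsub := integral_comp_mul_left_Ioi
    (fun u => Real.exp (-u) * (Real.exp (-((a * b) ^ 2 / (4 * u))) / (2 * u))) 0
    (by positivity : 0 < b ^ 2)
  have hb2 : b ^ 2 ≠ 0 := by positivity
  rw [mul_zero, smul_eq_mul, eq_inv_mul_iff_mul_eq₀ hb2, ← integral_const_mul] at hsub
  rw [← hsub]
  refine setIntegral_congr_fun measurableSet_Ioi fun s hs => ?_
  have hs0 : s ≠ 0 := (mem_Ioi.1 hs).ne'
  have e : (a * b) ^ 2 / (4 * (b ^ 2 * s)) = a ^ 2 / (4 * s) := by field_simp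
  simp only [e]
  field_simp
end

section
/- Let 0 < a < b, let ν satisfy 0 < ν < 1/2, let λ satisfy −1/2 < λ < 1/2, and let ρ > ν + |λ|. Then ∫_0^∞ x^{ρ−1} K_ν(a x) K_λ(b x) dx = 2^{ρ−3} b^{ν−ρ} a^{−ν} Γ(ν) Γ((ρ−ν+λ)/2) Γ((ρ−ν−λ)/2) · Σ_{n=0}^∞ [ ((ρ−ν+λ)/2)_n ((ρ−ν−λ)/2)_n / ((1−ν)_n n!) ] (a²/b²)^n + 2^{ρ−3} a^{ν} b^{−ν−ρ} Γ(−ν) Γ((ρ+ν+λ)/2) Γ((ρ+ν−λ)/2) · Σ_{n=0}^∞ [ ((ρ+ν+λ)/2)_n ((ρ+ν−λ)/2)_n / ((1+ν)_n n!) ] (a²/b²)^n. -/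
open MeasureTheory Filter Set

/-- The Pochhammer symbol `(q)ₙ = q (q+1) ⋯ (q+n-1)`. -/
noncomputable def poch (q : ℝ) (n : ℕ) : ℝ := ∏ i ∈ Finset.range n, (q + (i : ℝ))

/-- The entire function `∑ zⁿ / (Γ(1 + μ + n) n!)`, so that the modified Bessel function `I_μ(x)` is
`(x / 2) ^ μ` times its value at `x ^ 2 / 4`. -/
noncomputable def besselSeries (μ z : ℝ) : ℝ :=
  ∑' n : ℕ, z ^ n / (Real.Gamma (1 + μ + n) * n.factorial)

lemma gamma_add_natCast_succ {q : ℝ} (hq : 0 < q) (n : ℕ) :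
    Real.Gamma (q + (n + 1 : ℕ)) = (q + n) * Real.Gamma (q + n) := by
  have h : q + n ≠ 0 := by positivity
  rw [← Real.Gamma_add_one h]
  push_cast
  ring_nf

lemma summable_besselSeries {μ : ℝ} (hμ : -1 < μ) (z : ℝ) :
    Summable fun n : ℕ => z ^ n / (Real.Gamma (1 + μ + n) * n.factorial) := by
  rcases eq_or_ne z 0 with rfl | hz
  · refine summable_of_ne_finset_zero (s := {0}) fun n hn => ?_
    have : n ≠ 0 := by simpa using hn
    simp [this]
  have h1 : 0 < 1 + μ := by linarith
  have hG : ∀ n : ℕ, 0 < Real.Gamma (1 + μ + n) := fun n => Real.Gamma_pos_of_pos (by positivity)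
  refine summable_of_ratio_test_tendsto_lt_one (l := 0) one_pos
    (Eventually.of_forall fun n => ?_) ?_
  · have := hG n
    positivity
  · have e : (fun n : ℕ => ‖z ^ (n + 1) / (Real.Gamma (1 + μ + (n + 1 : ℕ)) * (n + 1).factorial)‖ /
        ‖z ^ n / (Real.Gamma (1 + μ + n) * n.factorial)‖) =
        fun n : ℕ => |z| * ((1 + μ + n)⁻¹ * ((n : ℝ) + 1)⁻¹) := by
      funext n
      have := hG n
      have h2 : 0 < 1 + μ + n := by positivity
      rw [gamma_add_natCast_succ h1, Nat.factorial_succ]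
      simp only [norm_div, norm_mul, norm_pow, Real.norm_eq_abs, abs_of_pos this, abs_of_pos h2,
        Nat.cast_mul, Nat.cast_add, Nat.cast_one, Nat.abs_cast,
        abs_of_pos (show (0 : ℝ) < n + 1 by positivity)]
      have : 0 < |z| := abs_pos.mpr hz
      field_simp
      ring
    rw [e]
    have l1 : Tendsto (fun n : ℕ => (1 + μ + n : ℝ)⁻¹) atTop (nhds 0) :=
      tendsto_inv_atTop_zero.comp (tendsto_atTop_add_const_left _ _ tendsto_natCast_atTop_atTop)
    have l2 : Tendsto (fun n : ℕ => ((n : ℝ) + 1)⁻¹) atTop (nhds 0) :=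
      tendsto_inv_atTop_zero.comp (tendsto_atTop_add_const_right _ _ tendsto_natCast_atTop_atTop)
    simpa using (l1.mul l2).const_mul |z|

lemma besselSeries_zero (μ : ℝ) : besselSeries μ 0 = 1 / Real.Gamma (1 + μ) := by
  rw [besselSeries, tsum_eq_single 0]
  · simp
  · intro n hn
    simp [hn]

lemma hasDerivAt_besselSeries {μ : ℝ} (hμ : -1 < μ) (z : ℝ) :
    HasDerivAt (besselSeries μ) (besselSeries (μ + 1) z) z := by
  have h1 : 0 < 1 + μ := by linarith
  have hG : ∀ n : ℕ, 0 < Real.Gamma (1 + μ + n) := fun n => Real.Gamma_pos_of_pos (by positivity)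
  have shift : ∀ (w : ℝ) (n : ℕ),
      ((n + 1 : ℕ) : ℝ) * w ^ n / (Real.Gamma (1 + μ + (n + 1 : ℕ)) * (n + 1).factorial) =
        w ^ n / (Real.Gamma (1 + (μ + 1) + n) * n.factorial) := by
    intro w n
    have h2 : 1 + (μ + 1) + n = 1 + μ + ((n + 1 : ℕ) : ℝ) := by push_cast; ring
    have := hG (n + 1)
    rw [h2, Nat.factorial_succ]
    push_cast at this ⊢
    field_simp
  set R : ℝ := |z| + 1 with hR
  have hsum : Summable fun n : ℕ => (n : ℝ) * R ^ (n - 1) /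
      (Real.Gamma (1 + μ + n) * n.factorial) := by
    rw [← summable_nat_add_iff 1]
    simpa only [Nat.add_sub_cancel, shift] using
      summable_besselSeries (show -1 < μ + 1 by linarith) R
  have key := hasDerivAt_tsum_of_isPreconnected (𝕜 := ℝ)
    (g := fun (n : ℕ) (w : ℝ) => w ^ n / (Real.Gamma (1 + μ + n) * n.factorial))
    (g' := fun (n : ℕ) (w : ℝ) => (n : ℝ) * w ^ (n - 1) / (Real.Gamma (1 + μ + n) * n.factorial))
    (t := Metric.ball (0 : ℝ) R) (y₀ := 0) (y := z) hsum Metric.isOpen_ball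
    (convex_ball _ _).isPreconnected
    (fun n w _ => (hasDerivAt_pow n w).div_const _)
    (fun n w hw => ?_) (Metric.mem_ball_self (by positivity)) (summable_besselSeries hμ 0)
    (by simp [hR])
  · have e : ∑' n : ℕ, (n : ℝ) * z ^ (n - 1) / (Real.Gamma (1 + μ + n) * n.factorial) =
        besselSeries (μ + 1) z := by
      have hs : Summable fun n : ℕ => (n : ℝ) * z ^ (n - 1) /
          (Real.Gamma (1 + μ + n) * n.factorial) := by
        rw [← summable_nat_add_iff 1]
        simpa only [Nat.add_sub_cancel, shift] using
          summable_besselSeries (show -1 < μ + 1 by linarith) z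
      rw [hs.tsum_eq_zero_add]
      simp only [Nat.add_sub_cancel, shift]
      simp [besselSeries]
    rw [← e]
    exact key
  · have := hG n
    have hw' : |w| ≤ R := by simpa using (mem_ball_zero_iff.mp hw).le
    rw [norm_div, norm_mul, norm_pow, norm_mul, Real.norm_eq_abs, Real.norm_eq_abs,
      Real.norm_eq_abs, Real.norm_eq_abs, abs_of_pos this, Nat.abs_cast, Nat.abs_cast]
    gcongr

lemma besselSeries_recurrence {μ : ℝ} (hμ : -1 < μ) (z : ℝ) :
    z * besselSeries (μ + 2) z + (1 + μ) * besselSeries (μ + 1) z = besselSeries μ z := by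
  have h1 : 0 < 1 + μ := by linarith
  have s0 := summable_besselSeries hμ z
  have s1 := summable_besselSeries (show -1 < μ + 1 by linarith) z
  have s2 := summable_besselSeries (show -1 < μ + 2 by linarith) z
  unfold besselSeries
  rw [s1.tsum_eq_zero_add, s0.tsum_eq_zero_add, mul_add, ← tsum_mul_left, ← tsum_mul_left,
    add_left_comm,
    ← (s2.mul_left z).tsum_add (((summable_nat_add_iff 1).mpr s1).mul_left (1 + μ))]
  congr 1
  · have : Real.Gamma (1 + (μ + 1)) = (1 + μ) * Real.Gamma (1 + μ) := by
      rw [← Real.Gamma_add_one h1.ne']; ring_nf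
    have := Real.Gamma_pos_of_pos h1
    simp [*]
    field_simp
  · refine tsum_congr fun n => ?_
    have hq : 0 < 1 + μ + ((n + 1 : ℕ) : ℝ) := by positivity
    have e1 : Real.Gamma (1 + (μ + 2) + n) =
        (1 + μ + (n + 1 : ℕ)) * Real.Gamma (1 + μ + (n + 1 : ℕ)) := by
      rw [← Real.Gamma_add_one hq.ne']; push_cast; ring_nf
    have e2 : Real.Gamma (1 + (μ + 1) + (n + 1 : ℕ)) =
        (1 + μ + (n + 1 : ℕ)) * Real.Gamma (1 + μ + (n + 1 : ℕ)) := by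
      rw [← Real.Gamma_add_one hq.ne']; push_cast; ring_nf
    have := Real.Gamma_pos_of_pos hq
    rw [e1, e2, Nat.factorial_succ]
    push_cast at hq this ⊢
    field_simp
    ring
lemma integrableOn_rpow_mul_exp_neg_inv {q : ℝ} (hq : 0 < q) :
    IntegrableOn (fun u : ℝ => u ^ (-q - 1) * Real.exp (-u⁻¹)) (Ioi 0) := by
  have h := (integrableOn_Ioi_comp_rpow_iff (fun u : ℝ => Real.exp (-u) * u ^ (q - 1))
    (p := -1) (by norm_num)).mpr (Real.GammaIntegral_convergent hq)
  refine h.congr_fun (fun u hu => ?_) measurableSet_Ioi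
  have hu : 0 < u := hu
  simp only [smul_eq_mul, abs_neg, abs_one, one_mul]
  rw [← Real.rpow_mul hu.le, Real.rpow_neg_one, mul_left_comm, ← Real.rpow_add hu, mul_comm]
  ring_nf

lemma integral_rpow_mul_exp_neg_inv {q : ℝ} (hq : 0 < q) :
    ∫ u in Ioi (0 : ℝ), u ^ (-q - 1) * Real.exp (-u⁻¹) = Real.Gamma q := by
  rw [Real.Gamma_eq_integral hq, ← integral_comp_rpow_Ioi
    (fun u : ℝ => Real.exp (-u) * u ^ (q - 1)) (p := -1) (by norm_num)]
  refine setIntegral_congr_fun measurableSet_Ioi fun u hu => ?_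
  have hu : 0 < u := hu
  simp only [smul_eq_mul, abs_neg, abs_one, one_mul]
  rw [← Real.rpow_mul hu.le, Real.rpow_neg_one, mul_left_comm, ← Real.rpow_add hu, mul_comm]
  ring_nf

lemma integrableOn_rpow_mul_exp_neg_mul {p z : ℝ} (hp : 0 < p) (hz : 0 < z) :
    IntegrableOn (fun u : ℝ => u ^ (p - 1) * Real.exp (-(z * u))) (Ioi 0) := by
  simpa using integrableOn_rpow_mul_exp_neg_mul_rpow (p := 1) (s := p - 1) (b := z)
    (by linarith) one_pos hz

/-- The integral `∫₀^∞ u ^ (p - 1) exp (-z u - 1 / u) du`, which is `2 z ^ (-p / 2) K_p (2 √z)`. -/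
noncomputable def besselIntegral (p z : ℝ) : ℝ :=
  ∫ u in Ioi (0 : ℝ), u ^ (p - 1) * Real.exp (-(z * u) - u⁻¹)

lemma integrableOn_besselIntegral {p z : ℝ} (hp : p ≠ 0) (hz : 0 < z) :
    IntegrableOn (fun u : ℝ => u ^ (p - 1) * Real.exp (-(z * u) - u⁻¹)) (Ioi 0) := by
  have hm : AEStronglyMeasurable (fun u : ℝ => u ^ (p - 1) * Real.exp (-(z * u) - u⁻¹))
      (volume.restrict (Ioi 0)) := by
    have : Measurable fun u : ℝ => u ^ (p - 1) * Real.exp (-(z * u) - u⁻¹) := by fun_prop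
    exact this.aestronglyMeasurable
  rcases lt_or_gt_of_ne hp with h | h
  · refine (integrableOn_rpow_mul_exp_neg_inv (neg_pos.mpr h)).mono' hm ?_
    refine (ae_restrict_mem measurableSet_Ioi).mono fun u hu => ?_
    have hu : 0 < u := hu
    rw [Real.norm_of_nonneg (by positivity), neg_neg]
    gcongr
    have : 0 < z * u := by positivity
    linarith
  · refine (integrableOn_rpow_mul_exp_neg_mul h hz).mono' hm ?_
    refine (ae_restrict_mem measurableSet_Ioi).mono fun u hu => ?_
    have hu : 0 < u := hu
    rw [Real.norm_of_nonneg (by positivity)]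
    gcongr
    have : 0 < u⁻¹ := by positivity
    linarith

lemma hasDerivAt_besselIntegral {p z : ℝ} (hp : 0 < p) (hz : 0 < z) :
    HasDerivAt (besselIntegral p) (-besselIntegral (p + 1) z) z := by
  have hmeas : ∀ q y : ℝ, AEStronglyMeasurable
      (fun u : ℝ => u ^ q * Real.exp (-(y * u) - u⁻¹)) (volume.restrict (Ioi 0)) := by
    intro q y
    have : Measurable fun u : ℝ => u ^ q * Real.exp (-(y * u) - u⁻¹) := by fun_prop
    exact this.aestronglyMeasurable
  have h := (hasDerivAt_integral_of_dominated_loc_of_deriv_le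
    (μ := volume.restrict (Ioi (0 : ℝ)))
    (F := fun (y u : ℝ) => u ^ (p - 1) * Real.exp (-(y * u) - u⁻¹))
    (F' := fun (y u : ℝ) => -(u ^ (p + 1 - 1) * Real.exp (-(y * u) - u⁻¹)))
    (bound := fun u : ℝ => u ^ (p + 1 - 1) * Real.exp (-(z / 2 * u)))
    (x₀ := z) (s := Ioi (z / 2)) (Ioi_mem_nhds (by linarith))
    (Eventually.of_forall fun y => hmeas _ _)
    (integrableOn_besselIntegral hp.ne' hz) (hmeas _ _).neg ?_
    (integrableOn_rpow_mul_exp_neg_mul (by linarith) (by linarith)) ?_).2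
  · rw [integral_neg] at h
    exact h
  · refine (ae_restrict_mem measurableSet_Ioi).mono fun u hu y hy => ?_
    have hu : 0 < u := hu
    have hy : z / 2 < y := hy
    rw [norm_neg, Real.norm_of_nonneg (by positivity)]
    gcongr
    have : 0 < u⁻¹ := by positivity
    have : z / 2 * u < y * u := by gcongr
    linarith
  · refine (ae_restrict_mem measurableSet_Ioi).mono fun u hu y _ => ?_
    have hu : 0 < u := hu
    have h1 : HasDerivAt (fun y : ℝ => -(y * u) - u⁻¹) (-(1 * u)) y :=
      ((hasDerivAt_id y).mul_const u).neg.sub_const _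
    refine (h1.exp.const_mul (u ^ (p - 1))).congr_deriv ?_
    rw [show p + 1 - 1 = (p - 1) + 1 by ring, Real.rpow_add_one hu.ne']
    ring

lemma tendsto_rpow_nhdsGT_zero {p : ℝ} (hp : 0 < p) :
    Tendsto (fun z : ℝ => z ^ p) (nhdsWithin 0 (Ioi 0)) (nhds 0) := by
  have := (Real.continuousAt_rpow_const 0 p (Or.inr hp.le)).tendsto.mono_left
    (nhdsWithin_le_nhds (s := Ioi 0))
  simpa [Real.zero_rpow hp.ne'] using this

lemma tendsto_rpow_mul_exp_neg_nhdsGT {p z : ℝ} (hp : 0 < p) (hz : 0 < z) :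
    Tendsto (fun u : ℝ => u ^ p * Real.exp (-(z * u) - u⁻¹)) (nhdsWithin 0 (Ioi 0)) (nhds 0) := by
  refine squeeze_zero' ?_ ?_ (tendsto_rpow_nhdsGT_zero hp)
  · filter_upwards [self_mem_nhdsWithin] with u hu
    have hu : 0 < u := hu
    positivity
  · filter_upwards [self_mem_nhdsWithin] with u hu
    have hu : 0 < u := hu
    have h1 : Real.exp (-(z * u) - u⁻¹) ≤ 1 := by
      rw [Real.exp_le_one_iff]
      have : 0 < z * u := by positivity
      have : 0 < u⁻¹ := by positivity
      linarith
    exact mul_le_of_le_one_right (by positivity) h1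

lemma tendsto_rpow_mul_exp_neg_atTop (p : ℝ) {z : ℝ} (hz : 0 < z) :
    Tendsto (fun u : ℝ => u ^ p * Real.exp (-(z * u) - u⁻¹)) atTop (nhds 0) := by
  refine squeeze_zero' ?_ ?_ (tendsto_rpow_mul_exp_neg_mul_atTop_nhds_zero p z hz)
  · filter_upwards [Ioi_mem_atTop 0] with u hu
    have hu : 0 < u := hu
    positivity
  · filter_upwards [Ioi_mem_atTop 0] with u hu
    have hu : 0 < u := hu
    have : 0 < u⁻¹ := by positivity
    gcongr
    linarith

lemma besselIntegral_recurrence {p z : ℝ} (hp : 0 < p) (hp1 : p ≠ 1) (hz : 0 < z) :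
    z * besselIntegral (p + 1) z = p * besselIntegral p z + besselIntegral (p - 1) z := by
  have i0 := (integrableOn_besselIntegral hp.ne' hz).const_mul p
  have i1 := integrableOn_besselIntegral (sub_ne_zero.mpr hp1) hz
  have i2 := (integrableOn_besselIntegral (show p + 1 ≠ 0 by positivity) hz).const_mul z
  have h := integral_Ioi_of_hasDerivAt_of_tendsto (a := (0 : ℝ)) (m := 0)
    (f := fun u : ℝ => u ^ p * Real.exp (-(z * u) - u⁻¹))
    (f' := fun u : ℝ => p * (u ^ (p - 1) * Real.exp (-(z * u) - u⁻¹)) +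
      u ^ (p - 1 - 1) * Real.exp (-(z * u) - u⁻¹) -
      z * (u ^ (p + 1 - 1) * Real.exp (-(z * u) - u⁻¹))) ?_ (fun u hu => ?_)
    ((i0.add i1).sub i2) (tendsto_rpow_mul_exp_neg_atTop p hz)
  · have e1 := integral_sub (i0.add i1) i2
    have e2 := integral_add i0 i1
    simp only [Pi.add_apply] at e1
    rw [e1, e2, integral_const_mul, integral_const_mul, Real.zero_rpow hp.ne'] at h
    unfold besselIntegral
    linarith
  · rw [← continuousWithinAt_Ioi_iff_Ici, ContinuousWithinAt, Real.zero_rpow hp.ne', zero_mul]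
    exact tendsto_rpow_mul_exp_neg_nhdsGT hp hz
  · have hu : 0 < u := hu
    have h1 : HasDerivAt (fun u : ℝ => -(z * u) - u⁻¹) (-(z * 1) - -(u ^ 2)⁻¹) u :=
      ((hasDerivAt_id u).const_mul z).neg.sub (hasDerivAt_inv hu.ne')
    refine ((Real.hasDerivAt_rpow_const (Or.inl hu.ne')).mul h1.exp).congr_deriv ?_
    have a1 : u ^ (p - 1) = u ^ (p - 1 - 1) * u := by
      rw [← Real.rpow_add_one hu.ne']; ring_nf
    have a2 : u ^ (p + 1 - 1) = u ^ (p - 1 - 1) * u ^ 2 := by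
      rw [← Real.rpow_natCast, ← Real.rpow_add hu]; push_cast; ring_nf
    have a3 : u ^ p = u ^ (p - 1 - 1) * u ^ 2 := by
      rw [← a2]; ring_nf
    rw [a1, a2, a3]
    field_simp
    ring

lemma rpow_mul_besselIntegral {p z : ℝ} (hz : 0 < z) :
    z ^ p * besselIntegral p z =
      ∫ v in Ioi (0 : ℝ), v ^ (p - 1) * Real.exp (-v - z * v⁻¹) := by
  have h := integral_comp_mul_left_Ioi
    (fun v : ℝ => v ^ (p - 1) * Real.exp (-v - z * v⁻¹)) 0 hz
  rw [mul_zero, smul_eq_mul, eq_inv_mul_iff_mul_eq₀ hz.ne', ← integral_const_mul] at h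
  rw [← h, besselIntegral, ← integral_const_mul]
  refine setIntegral_congr_fun measurableSet_Ioi fun u hu => ?_
  have hu : 0 < u := hu
  have e : z ^ p = z * z ^ (p - 1) := by
    rw [mul_comm, ← Real.rpow_add_one hz.ne']; ring_nf
  rw [Real.mul_rpow hz.le hu.le, mul_inv, mul_inv_cancel_left₀ hz.ne', e]
  ring

lemma tendsto_rpow_mul_besselIntegral {p : ℝ} (hp : 0 < p) :
    Tendsto (fun z => z ^ p * besselIntegral p z) (nhdsWithin 0 (Ioi 0))
      (nhds (Real.Gamma p)) := by
  have hmeas : ∀ z : ℝ, AEStronglyMeasurable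
      (fun v : ℝ => v ^ (p - 1) * Real.exp (-v - z * v⁻¹)) (volume.restrict (Ioi 0)) := by
    intro z
    have : Measurable fun v : ℝ => v ^ (p - 1) * Real.exp (-v - z * v⁻¹) := by fun_prop
    exact this.aestronglyMeasurable
  have h := tendsto_integral_filter_of_dominated_convergence
    (μ := volume.restrict (Ioi (0 : ℝ))) (l := nhdsWithin (0 : ℝ) (Ioi 0))
    (F := fun (z v : ℝ) => v ^ (p - 1) * Real.exp (-v - z * v⁻¹))
    (f := fun v : ℝ => v ^ (p - 1) * Real.exp (-v - 0 * v⁻¹))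
    (fun v : ℝ => v ^ (p - 1) * Real.exp (-(1 * v)))
    (Eventually.of_forall hmeas) ?_ (integrableOn_rpow_mul_exp_neg_mul hp one_pos) ?_
  · have e : ∫ v in Ioi (0 : ℝ), v ^ (p - 1) * Real.exp (-v - 0 * v⁻¹) = Real.Gamma p := by
      rw [Real.Gamma_eq_integral hp]
      refine integral_congr_ae (Eventually.of_forall fun v => ?_)
      simp [mul_comm]
    rw [e] at h
    refine h.congr' ?_
    filter_upwards [self_mem_nhdsWithin] with z hz
    exact (rpow_mul_besselIntegral hz).symm
  · filter_upwards [self_mem_nhdsWithin] with z hz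
    refine (ae_restrict_mem measurableSet_Ioi).mono fun u hu => ?_
    have hz : 0 < z := hz
    have hu : 0 < u := hu
    rw [Real.norm_of_nonneg (by positivity)]
    gcongr
    have : 0 < z * u⁻¹ := by positivity
    linarith
  · refine Eventually.of_forall fun v => Tendsto.mono_left ?_ nhdsWithin_le_nhds
    have : Continuous fun z : ℝ => v ^ (p - 1) * Real.exp (-v - z * v⁻¹) := by fun_prop
    exact this.tendsto 0

lemma tendsto_besselIntegral_neg {q : ℝ} (hq : 0 < q) :
    Tendsto (besselIntegral (-q)) (nhdsWithin 0 (Ioi 0)) (nhds (Real.Gamma q)) := by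
  have h := tendsto_rpow_mul_besselIntegral hq
  refine h.congr' ?_
  filter_upwards [self_mem_nhdsWithin] with z hz
  have hz : 0 < z := hz
  rw [rpow_mul_besselIntegral hz, besselIntegral, ← integral_comp_rpow_Ioi
    (fun v : ℝ => v ^ (q - 1) * Real.exp (-v - z * v⁻¹)) (p := -1) (by norm_num)]
  refine setIntegral_congr_fun measurableSet_Ioi fun u hu => ?_
  have hu : 0 < u := hu
  simp only [smul_eq_mul, abs_neg, abs_one, one_mul]
  rw [← Real.rpow_mul hu.le, Real.rpow_neg_one, ← mul_assoc, ← Real.rpow_add hu, inv_inv]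
  ring_nf

/-- Abel's identity for `z f'' + c f' = f`, with the constant read off at `0`. -/
lemma wronskian_eq_of_tendsto {c L : ℝ} {f f₁ f₂ g g₁ g₂ : ℝ → ℝ}
    (hf : ∀ z, 0 < z → HasDerivAt f (f₁ z) z) (hf₁ : ∀ z, 0 < z → HasDerivAt f₁ (f₂ z) z)
    (hg : ∀ z, 0 < z → HasDerivAt g (g₁ z) z) (hg₁ : ∀ z, 0 < z → HasDerivAt g₁ (g₂ z) z)
    (ef : ∀ z, 0 < z → z * f₂ z + c * f₁ z = f z)
    (eg : ∀ z, 0 < z → z * g₂ z + c * g₁ z = g z)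
    (hL : Tendsto (fun z => z ^ c * (f z * g₁ z - f₁ z * g z)) (nhdsWithin 0 (Ioi 0)) (nhds L))
    {z : ℝ} (hz : 0 < z) : z ^ c * (f z * g₁ z - f₁ z * g z) = L := by
  have hd : ∀ w, 0 < w →
      HasDerivAt (fun z => z ^ c * (f z * g₁ z - f₁ z * g z)) 0 w := by
    intro w hw
    refine ((Real.hasDerivAt_rpow_const (p := c) (Or.inl hw.ne')).mul
      (((hf w hw).mul (hg₁ w hw)).sub ((hf₁ w hw).mul (hg w hw)))).congr_deriv ?_
    have e : w ^ c = w ^ (c - 1) * w := by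
      rw [← Real.rpow_add_one hw.ne']; ring_nf
    rw [e]
    simp only [Pi.sub_apply, Pi.mul_apply]
    linear_combination w ^ (c - 1) * f w * eg w hw - w ^ (c - 1) * g w * ef w hw
  have hc : ∀ w, 0 < w → w ^ c * (f w * g₁ w - f₁ w * g w) =
      z ^ c * (f z * g₁ z - f₁ z * g z) := fun w hw =>
    isOpen_Ioi.is_const_of_deriv_eq_zero isPreconnected_Ioi
      (fun w hw => (hd w hw).differentiableAt.differentiableWithinAt)
      (fun w hw => (hd w hw).deriv) (show w ∈ Ioi 0 from hw) (show z ∈ Ioi 0 from hz)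
  refine tendsto_nhds_unique (tendsto_const_nhds.congr' ?_) hL
  filter_upwards [self_mem_nhdsWithin] with w hw
  exact (hc w hw).symm

lemma tendsto_besselSeries {μ : ℝ} (hμ : -1 < μ) :
    Tendsto (besselSeries μ) (nhdsWithin 0 (Ioi 0)) (nhds (1 / Real.Gamma (1 + μ))) := by
  rw [← besselSeries_zero]
  exact (hasDerivAt_besselSeries hμ 0).continuousAt.tendsto.mono_left nhdsWithin_le_nhds

lemma besselIntegral_eq_besselSeries {ν z : ℝ} (hν0 : 0 < ν) (hν1 : ν < 1) (hz : 0 < z) :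
    besselIntegral ν z = Real.Gamma (1 + ν) * Real.Gamma (1 - ν) / ν *
      (z ^ (-ν) * besselSeries (-ν) z - besselSeries ν z) := by
  have hid : Tendsto (fun z : ℝ => z) (nhdsWithin 0 (Ioi 0)) (nhds 0) := nhdsWithin_le_nhds
  have hG1 := Real.Gamma_pos_of_pos (show 0 < 1 + ν by linarith)
  have hG2 := Real.Gamma_pos_of_pos (show 0 < 1 - ν by linarith)
  have hGν := Real.Gamma_add_one hν0.ne'
  have dS : ∀ {μ : ℝ}, -1 < μ → ∀ z, HasDerivAt (besselSeries μ) (besselSeries (μ + 1) z) z :=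
    fun h z => hasDerivAt_besselSeries h z
  have hg : ∀ z, 0 < z → HasDerivAt (besselIntegral ν) (-besselIntegral (ν + 1) z) z :=
    fun z hz => hasDerivAt_besselIntegral hν0 hz
  have hg₁ : ∀ z, 0 < z → HasDerivAt (fun z => -besselIntegral (ν + 1) z)
      (besselIntegral (ν + 2) z) z := fun z hz =>
    ((hasDerivAt_besselIntegral (show 0 < ν + 1 by linarith) hz).neg).congr_deriv
      (by rw [neg_neg]; ring_nf)
  have eg : ∀ z, 0 < z → z * besselIntegral (ν + 2) z + (ν + 1) * -besselIntegral (ν + 1) z =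
      besselIntegral ν z := by
    intro z hz
    have := besselIntegral_recurrence (show 0 < ν + 1 by linarith) (by linarith) hz
    rw [show ν + 1 + 1 = ν + 2 by ring, show ν + 1 - 1 = ν by ring] at this
    linarith
  have hf : ∀ z, 0 < z → HasDerivAt (besselSeries ν) (besselSeries (ν + 1) z) z :=
    fun z _ => dS (by linarith) z
  have hf₁ : ∀ z, 0 < z → HasDerivAt (besselSeries (ν + 1)) (besselSeries (ν + 2) z) z :=
    fun z _ => (dS (by linarith) z).congr_deriv (by ring_nf)
  have ef : ∀ z, 0 < z → z * besselSeries (ν + 2) z + (ν + 1) * besselSeries (ν + 1) z =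
      besselSeries ν z := by
    intro z _
    rw [add_comm ν 1, add_comm 1 ν]
    linarith [besselSeries_recurrence (show -1 < ν by linarith) z]
  have hh : ∀ z, 0 < z → HasDerivAt (fun z => z ^ (-ν) * besselSeries (-ν) z)
      (-ν * z ^ (-ν - 1) * besselSeries (-ν) z + z ^ (-ν) * besselSeries (-ν + 1) z) z :=
    fun z hz => (Real.hasDerivAt_rpow_const (Or.inl hz.ne')).mul (dS (by linarith) z)
  have hh₁ : ∀ z, 0 < z → HasDerivAt
      (fun z => -ν * z ^ (-ν - 1) * besselSeries (-ν) z + z ^ (-ν) * besselSeries (-ν + 1) z)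
      (-ν * ((-ν - 1) * z ^ (-ν - 1 - 1)) * besselSeries (-ν) z +
        2 * (-ν * z ^ (-ν - 1) * besselSeries (-ν + 1) z) +
        z ^ (-ν) * besselSeries (-ν + 2) z) z := by
    intro z hz
    refine ((((Real.hasDerivAt_rpow_const (p := -ν - 1) (Or.inl hz.ne')).const_mul (-ν)).mul
      (dS (show -1 < -ν by linarith) z)).add
      ((Real.hasDerivAt_rpow_const (p := -ν) (Or.inl hz.ne')).mul
      (dS (show -1 < -ν + 1 by linarith) z))).congr_deriv ?_
    ring_nf
  have eh : ∀ z, 0 < z → z * (-ν * ((-ν - 1) * z ^ (-ν - 1 - 1)) * besselSeries (-ν) z +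
        2 * (-ν * z ^ (-ν - 1) * besselSeries (-ν + 1) z) +
        z ^ (-ν) * besselSeries (-ν + 2) z) +
      (ν + 1) * (-ν * z ^ (-ν - 1) * besselSeries (-ν) z + z ^ (-ν) * besselSeries (-ν + 1) z) =
      z ^ (-ν) * besselSeries (-ν) z := by
    intro z hz
    have a1 : z ^ (-ν - 1) = z ^ (-ν - 1 - 1) * z := by
      rw [← Real.rpow_add_one hz.ne']; ring_nf
    have a2 : z ^ (-ν) = z ^ (-ν - 1) * z := by
      rw [← Real.rpow_add_one hz.ne']; ring_nf
    rw [a2, a1]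
    linear_combination z ^ (-ν - 1 - 1) * z ^ 2 *
      besselSeries_recurrence (show -1 < -ν by linarith) z
  have lφ := tendsto_besselSeries (show -1 < ν by linarith)
  have lφ₁ := tendsto_besselSeries (show -1 < ν + 1 by linarith)
  have lψ := tendsto_besselSeries (show -1 < -ν by linarith)
  have lψ₁ := tendsto_besselSeries (show -1 < -ν + 1 by linarith)
  have lg := tendsto_rpow_mul_besselIntegral hν0
  have lg' := tendsto_besselIntegral_neg (show 0 < 1 - ν by linarith)
  have lzg : Tendsto (fun z => z * besselIntegral ν z) (nhdsWithin 0 (Ioi 0)) (nhds 0) := by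
    have := (tendsto_rpow_nhdsGT_zero (show 0 < 1 - ν by linarith)).mul lg
    rw [zero_mul] at this
    refine this.congr' ?_
    filter_upwards [self_mem_nhdsWithin] with z hz
    rw [← mul_assoc, ← Real.rpow_add hz]
    simp
  have hrec : ∀ z, 0 < z → z * besselIntegral (ν + 1) z =
      ν * besselIntegral ν z + besselIntegral (-(1 - ν)) z := by
    intro z hz
    rw [besselIntegral_recurrence hν0 hν1.ne hz]
    ring_nf
  have W₁ := wronskian_eq_of_tendsto (c := ν + 1) (L := 1) hg hg₁ hf hf₁ eg ef (by
    have l := ((hid.mul lg).mul lφ₁).add (((lg.const_mul ν).add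
      ((tendsto_rpow_nhdsGT_zero hν0).mul lg')).mul lφ)
    have e : 0 * Real.Gamma ν * (1 / Real.Gamma (1 + (ν + 1))) +
        (ν * Real.Gamma ν + 0 * Real.Gamma (1 - ν)) * (1 / Real.Gamma (1 + ν)) = 1 := by
      rw [add_comm 1 ν] at hG1 ⊢
      rw [← hGν]
      field_simp
      ring
    rw [e] at l
    refine l.congr' ?_
    filter_upwards [self_mem_nhdsWithin] with z hz
    have hz : 0 < z := hz
    rw [Real.rpow_add_one hz.ne']
    linear_combination (-z ^ ν * besselSeries ν z) * hrec z hz) hz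
  have W₂ := wronskian_eq_of_tendsto (c := ν + 1) (L := 1) hg hg₁ hh hh₁ eg eh (by
    have l := (lψ.mul lg').add (lzg.mul lψ₁)
    have e : 1 / Real.Gamma (1 + -ν) * Real.Gamma (1 - ν) +
        0 * (1 / Real.Gamma (1 + (-ν + 1))) = 1 := by
      rw [← sub_eq_add_neg]
      field_simp
      ring
    rw [e] at l
    refine l.congr' ?_
    filter_upwards [self_mem_nhdsWithin] with z hz
    have hz : 0 < z := hz
    have a2 : z ^ (-ν) = z ^ (-ν - 1) * z := by
      rw [← Real.rpow_add_one hz.ne']; ring_nf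
    have a3 : z ^ (ν + 1) * z ^ (-ν - 1) = 1 := by
      rw [← Real.rpow_add hz]; ring_nf; simp
    rw [a2]
    linear_combination (-besselSeries (-ν) z) * hrec z hz -
      (besselIntegral ν z * (-ν * besselSeries (-ν) z + z * besselSeries (-ν + 1) z) +
        z * besselIntegral (ν + 1) z * besselSeries (-ν) z) * a3) hz
  have W₃ := wronskian_eq_of_tendsto (c := ν + 1)
    (L := -ν / (Real.Gamma (1 + ν) * Real.Gamma (1 - ν))) hf hf₁ hh hh₁ ef eh (by
    have l := (lφ.mul ((lψ.const_mul (-ν)).add (hid.mul lψ₁))).sub ((lφ₁.mul hid).mul lψ)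
    have e : 1 / Real.Gamma (1 + ν) * (-ν * (1 / Real.Gamma (1 + -ν)) +
        0 * (1 / Real.Gamma (1 + (-ν + 1)))) -
        1 / Real.Gamma (1 + (ν + 1)) * 0 * (1 / Real.Gamma (1 + -ν)) =
        -ν / (Real.Gamma (1 + ν) * Real.Gamma (1 - ν)) := by
      rw [← sub_eq_add_neg]
      field_simp
      ring
    rw [e] at l
    refine l.congr' ?_
    filter_upwards [self_mem_nhdsWithin] with z hz
    have hz : 0 < z := hz
    have a2 : z ^ (-ν) = z ^ (-ν - 1) * z := by
      rw [← Real.rpow_add_one hz.ne']; ring_nf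
    have a3 : z ^ (ν + 1) * z ^ (-ν - 1) = 1 := by
      rw [← Real.rpow_add hz]; ring_nf; simp
    rw [a2]
    linear_combination (-(besselSeries ν z * (-ν * besselSeries (-ν) z +
      z * besselSeries (-ν + 1) z) - besselSeries (ν + 1) z * z * besselSeries (-ν) z)) * a3) hz
  have key : besselIntegral ν z * (-ν / (Real.Gamma (1 + ν) * Real.Gamma (1 - ν))) =
      besselSeries ν z - z ^ (-ν) * besselSeries (-ν) z := by
    rw [← W₃]
    linear_combination besselSeries ν z * W₂ - z ^ (-ν) * besselSeries (-ν) z * W₁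
  field_simp at key ⊢
  linear_combination -key

lemma integral_cos_mul_gaussian {u : ℝ} (hu : 0 < u) :
    ∫ t : ℝ, Real.cos t * Real.exp (-(u * t ^ 2)) =
      Real.sqrt (Real.pi / u) * Real.exp (-(4 * u)⁻¹) := by
  have h := fourierIntegral_gaussian (b := (u : ℂ)) (by simpa using hu) 1
  have hint : Integrable fun t : ℝ =>
      Complex.exp (Complex.I * 1 * t) * Complex.exp (-(u : ℂ) * t ^ 2) := by
    have hg := integrable_exp_neg_mul_sq hu
    refine hg.mono (by fun_prop) (Eventually.of_forall fun t => ?_)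
    have : ‖Complex.exp (Complex.I * 1 * t)‖ = 1 := by
      rw [Complex.norm_exp]; simp
    rw [norm_mul, this, one_mul, Complex.norm_exp]
    simp [← Complex.ofReal_pow]
  have h' := congrArg Complex.re h
  rw [← RCLike.re_eq_complex_re, ← integral_re hint] at h'
  have e1 : ∀ t : ℝ, RCLike.re (Complex.exp (Complex.I * 1 * t) *
      Complex.exp (-(u : ℂ) * t ^ 2)) = Real.cos t * Real.exp (-(u * t ^ 2)) := by
    intro t
    have e2 : Complex.exp (-(u : ℂ) * t ^ 2) = ((Real.exp (-(u * t ^ 2)) : ℝ) : ℂ) := by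
      push_cast; ring_nf
    rw [e2, RCLike.re_eq_complex_re, Complex.re_mul_ofReal, mul_one, mul_comm Complex.I,
      Complex.exp_ofReal_mul_I_re]
  simp only [e1] at h'
  rw [h', RCLike.re_eq_complex_re]
  have e3 : ((Real.pi : ℂ) / u) ^ (1 / 2 : ℂ) * Complex.exp (-1 ^ 2 / (4 * u)) =
      ((Real.sqrt (Real.pi / u) * Real.exp (-(4 * u)⁻¹) : ℝ) : ℂ) := by
    rw [Real.sqrt_eq_rpow]
    push_cast [Complex.ofReal_cpow (show 0 ≤ Real.pi / u by positivity)]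
    congr 2
    field_simp
  rw [e3, Complex.ofReal_re]

lemma tendsto_integral_cos_mul_gaussian {u : ℝ} (hu : 0 < u) :
    Tendsto (fun T : ℝ => ∫ t in (0 : ℝ)..T, Real.cos t * Real.exp (-(u * t ^ 2))) atTop
      (nhds (Real.sqrt Real.pi / 2 * (u ^ (-(1 / 2) : ℝ) * Real.exp (-(4 * u)⁻¹)))) := by
  have hint : Integrable fun t : ℝ => Real.cos t * Real.exp (-(u * t ^ 2)) := by
    refine (integrable_exp_neg_mul_sq hu).mono (by fun_prop) (Eventually.of_forall fun t => ?_)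
    rw [norm_mul, neg_mul]
    exact mul_le_of_le_one_left (norm_nonneg _) (Real.abs_cos_le_one t)
  have h := intervalIntegral_tendsto_integral_Ioi 0 hint.integrableOn tendsto_id
  have e := integral_comp_abs (f := fun t : ℝ => Real.cos t * Real.exp (-(u * t ^ 2)))
  simp only [Real.cos_abs, sq_abs, integral_cos_mul_gaussian hu] at e
  have e' : ∫ t in Ioi (0 : ℝ), Real.cos t * Real.exp (-(u * t ^ 2)) =
      Real.sqrt Real.pi / 2 * (u ^ (-(1 / 2) : ℝ) * Real.exp (-(4 * u)⁻¹)) := by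
    rw [Real.sqrt_div Real.pi_pos.le, Real.sqrt_eq_rpow u, div_eq_mul_inv,
      ← Real.rpow_neg hu.le] at e
    linarith
  rw [← e']
  exact h

lemma abs_integral_cos_mul_gaussian_le {u T : ℝ} (hu : 0 < u) (hT : 0 ≤ T) :
    |∫ t in (0 : ℝ)..T, Real.cos t * Real.exp (-(u * t ^ 2))| ≤ 2 := by
  have hE : ∀ t : ℝ, HasDerivAt (fun t : ℝ => Real.exp (-(u * t ^ 2)))
      (-(2 * u * t * Real.exp (-(u * t ^ 2)))) t := by
    intro t
    refine ((hasDerivAt_pow 2 t).const_mul u).neg.exp.congr_deriv ?_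
    simp only [Pi.neg_apply]
    push_cast
    ring
  have h1 := intervalIntegral.integral_mul_deriv_eq_deriv_mul (a := 0) (b := T)
    (u := fun t : ℝ => Real.exp (-(u * t ^ 2))) (v := Real.sin)
    (fun t _ => hE t) (fun t _ => Real.hasDerivAt_sin t)
    (Continuous.intervalIntegrable (by fun_prop) _ _)
    (Continuous.intervalIntegrable (by fun_prop) _ _)
  have h2 : ∫ t in (0 : ℝ)..T, 2 * u * t * Real.exp (-(u * t ^ 2)) =
      1 - Real.exp (-(u * T ^ 2)) := by
    have := intervalIntegral.integral_eq_sub_of_hasDerivAt (a := 0) (b := T)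
      (fun t _ => (hE t).neg) (Continuous.intervalIntegrable (by fun_prop) _ _)
    simp only [neg_neg] at this
    rw [this]
    simp
    ring
  have h3 : |∫ t in (0 : ℝ)..T, -(2 * u * t * Real.exp (-(u * t ^ 2))) * Real.sin t| ≤
      1 - Real.exp (-(u * T ^ 2)) := by
    rw [← h2]
    refine (intervalIntegral.abs_integral_le_integral_abs hT).trans ?_
    refine intervalIntegral.integral_mono_on hT (Continuous.intervalIntegrable (by fun_prop) _ _)
      (Continuous.intervalIntegrable (by fun_prop) _ _) fun t ht => ?_
    have ht0 : 0 ≤ t := ht.1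
    rw [abs_mul, abs_neg, abs_of_nonneg (by positivity)]
    exact mul_le_of_le_one_right (by positivity) (Real.abs_sin_le_one t)
  simp only [Real.sin_zero, mul_zero, sub_zero] at h1
  simp only [mul_comm (Real.cos _)]
  rw [h1]
  have h4 : |Real.exp (-(u * T ^ 2)) * Real.sin T| ≤ Real.exp (-(u * T ^ 2)) := by
    rw [abs_mul, abs_of_pos (Real.exp_pos _)]
    exact mul_le_of_le_one_right (Real.exp_pos _).le (Real.abs_sin_le_one T)
  have := abs_sub (Real.exp (-(u * T ^ 2)) * Real.sin T)
    (∫ t in (0 : ℝ)..T, -(2 * u * t * Real.exp (-(u * t ^ 2))) * Real.sin t)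
  linarith

lemma integral_cos_div_rpow_eq {s x T : ℝ} (hs : 0 < s) (hx : 0 < x) (hT : 0 ≤ T) :
    ∫ t in (0 : ℝ)..T, Real.cos t / (x ^ 2 + t ^ 2) ^ s =
      1 / Real.Gamma s * ∫ u in Ioi (0 : ℝ), u ^ (s - 1) * Real.exp (-(x ^ 2 * u)) *
        ∫ t in (0 : ℝ)..T, Real.cos t * Real.exp (-(u * t ^ 2)) := by
  have hG := Real.Gamma_pos_of_pos hs
  have hx2 : 0 < x ^ 2 := by positivity
  have e1 : ∀ t : ℝ, Real.cos t / (x ^ 2 + t ^ 2) ^ s = 1 / Real.Gamma s *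
      ∫ u in Ioi (0 : ℝ), u ^ (s - 1) * Real.exp (-(x ^ 2 * u)) *
        (Real.cos t * Real.exp (-(u * t ^ 2))) := by
    intro t
    have hr : 0 < x ^ 2 + t ^ 2 := by positivity
    have e2 : ∀ u : ℝ, u ^ (s - 1) * Real.exp (-(x ^ 2 * u)) *
        (Real.cos t * Real.exp (-(u * t ^ 2))) =
        Real.cos t * (u ^ (s - 1) * Real.exp (-((x ^ 2 + t ^ 2) * u))) := by
      intro u
      rw [show -((x ^ 2 + t ^ 2) * u) = -(x ^ 2 * u) + -(u * t ^ 2) by ring, Real.exp_add]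
      ring
    simp only [e2]
    rw [integral_const_mul, Real.integral_rpow_mul_exp_neg_mul_Ioi hs hr, one_div,
      one_div (x ^ 2 + t ^ 2), Real.inv_rpow hr.le]
    field_simp
  simp only [e1]
  rw [intervalIntegral.integral_const_mul]
  congr 1
  simp only [intervalIntegral.integral_of_le hT]
  rw [integral_integral_swap]
  · simp only [integral_const_mul]
  · have hb : Integrable (fun q : ℝ × ℝ => (1 : ℝ) * (q.2 ^ (s - 1) * Real.exp (-(x ^ 2 * q.2))))
        ((volume.restrict (Ioc 0 T)).prod (volume.restrict (Ioi 0))) :=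
      Integrable.mul_prod (f := fun _ : ℝ => (1 : ℝ)) (integrable_const _)
        (integrableOn_rpow_mul_exp_neg_mul hs hx2)
    refine hb.mono' ?_ ?_
    · have : Measurable (Function.uncurry fun t u : ℝ => u ^ (s - 1) * Real.exp (-(x ^ 2 * u)) *
          (Real.cos t * Real.exp (-(u * t ^ 2)))) := by
        unfold Function.uncurry
        fun_prop
      exact this.aestronglyMeasurable
    · rw [Measure.prod_restrict]
      refine (ae_restrict_mem (measurableSet_Ioc.prod measurableSet_Ioi)).mono fun q hq => ?_
      have hu : 0 < q.2 := hq.2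
      simp only [Function.uncurry]
      rw [norm_mul, Real.norm_of_nonneg (by positivity), one_mul]
      refine mul_le_of_le_one_right (by positivity) ?_
      rw [norm_mul, Real.norm_of_nonneg (Real.exp_pos _).le]
      refine mul_le_one₀ (Real.abs_cos_le_one _) (Real.exp_pos _).le ?_
      rw [Real.exp_le_one_iff]
      have : 0 ≤ q.2 * q.1 ^ 2 := by positivity
      linarith

lemma tendsto_integral_cos_div_rpow {ν x : ℝ} (hν : -1 / 2 < ν) (hx : 0 < x) :
    Tendsto (fun T => ∫ t in (0 : ℝ)..T, Real.cos t / (x ^ 2 + t ^ 2) ^ (ν + 1 / 2)) atTop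
      (nhds (1 / Real.Gamma (ν + 1 / 2) *
        (Real.sqrt Real.pi / 2 * (4 ^ (-ν) * besselIntegral ν (x ^ 2 / 4))))) := by
  have hs : 0 < ν + 1 / 2 := by linarith
  have hx2 : 0 < x ^ 2 := by positivity
  have hb := (integrableOn_rpow_mul_exp_neg_mul hs hx2).mul_const 2
  have hm : ∀ T : ℝ, AEStronglyMeasurable (fun u : ℝ => u ^ (ν + 1 / 2 - 1) *
      Real.exp (-(x ^ 2 * u)) * ∫ t in (0 : ℝ)..T, Real.cos t * Real.exp (-(u * t ^ 2)))
      (volume.restrict (Ioi 0)) := by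
    intro T
    have h1 : Measurable fun u : ℝ => u ^ (ν + 1 / 2 - 1) * Real.exp (-(x ^ 2 * u)) := by fun_prop
    have h2 : Continuous fun u : ℝ =>
        ∫ t in (0 : ℝ)..T, Real.cos t * Real.exp (-(u * t ^ 2)) :=
      intervalIntegral.continuous_parametric_intervalIntegral_of_continuous' (by fun_prop) _ _
    exact (h1.mul h2.measurable).aestronglyMeasurable
  have h := tendsto_integral_filter_of_dominated_convergence
    (μ := volume.restrict (Ioi (0 : ℝ))) (l := atTop)
    (F := fun (T u : ℝ) => u ^ (ν + 1 / 2 - 1) * Real.exp (-(x ^ 2 * u)) *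
      ∫ t in (0 : ℝ)..T, Real.cos t * Real.exp (-(u * t ^ 2)))
    (f := fun u : ℝ => u ^ (ν + 1 / 2 - 1) * Real.exp (-(x ^ 2 * u)) *
      (Real.sqrt Real.pi / 2 * (u ^ (-(1 / 2) : ℝ) * Real.exp (-(4 * u)⁻¹))))
    _ (Eventually.of_forall hm) ?_ hb ?_
  · have e : ∫ u in Ioi (0 : ℝ), u ^ (ν + 1 / 2 - 1) * Real.exp (-(x ^ 2 * u)) *
        (Real.sqrt Real.pi / 2 * (u ^ (-(1 / 2) : ℝ) * Real.exp (-(4 * u)⁻¹))) =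
        Real.sqrt Real.pi / 2 * (4 ^ (-ν) * besselIntegral ν (x ^ 2 / 4)) := by
      have hsub := integral_comp_mul_left_Ioi
        (fun v : ℝ => v ^ (ν - 1) * Real.exp (-(x ^ 2 / 4 * v) - v⁻¹)) 0
        (show (0 : ℝ) < 4 by norm_num)
      rw [mul_zero, smul_eq_mul] at hsub
      rw [besselIntegral, show (4 : ℝ) ^ (-ν) = 4 ^ (1 - ν) * 4⁻¹ by
        rw [← Real.rpow_neg_one, ← Real.rpow_add (by norm_num)]; ring_nf, mul_assoc, ← hsub,
        ← integral_const_mul, ← integral_const_mul]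
      refine setIntegral_congr_fun measurableSet_Ioi fun u hu => ?_
      have hu : 0 < u := hu
      have e1 : u ^ (ν - 1) = u ^ (ν + 1 / 2 - 1) * u ^ (-(1 / 2) : ℝ) := by
        rw [← Real.rpow_add hu]; ring_nf
      have e2 : (4 : ℝ) ^ (1 - ν) * 4 ^ (ν - 1) = 1 := by
        rw [← Real.rpow_add (by norm_num)]; simp
      rw [Real.mul_rpow (by norm_num) hu.le, sub_eq_add_neg _ (4 * u)⁻¹, Real.exp_add,
        show -(x ^ 2 / 4 * (4 * u)) = -(x ^ 2 * u) by ring, e1]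
      linear_combination (-Real.sqrt Real.pi / 2 * (u ^ (ν + 1 / 2 - 1) * u ^ (-(1 / 2) : ℝ)) *
        Real.exp (-(x ^ 2 * u)) * Real.exp (-(4 * u)⁻¹)) * e2
    rw [e] at h
    refine (h.const_mul (1 / Real.Gamma (ν + 1 / 2))).congr' ?_
    filter_upwards [Ici_mem_atTop 0] with T hT
    exact (integral_cos_div_rpow_eq hs hx hT).symm
  · filter_upwards [Ici_mem_atTop 0] with T hT
    refine (ae_restrict_mem measurableSet_Ioi).mono fun u hu => ?_
    have hu : 0 < u := hu
    rw [norm_mul, Real.norm_of_nonneg (by positivity)]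
    gcongr
    exact abs_integral_cos_mul_gaussian_le hu hT
  · refine (ae_restrict_mem measurableSet_Ioi).mono fun u hu => ?_
    exact (tendsto_integral_cos_mul_gaussian hu).const_mul _

/-- The modified Bessel function of the second kind on `(0, ∞)`. -/
noncomputable def macdonald (ν x : ℝ) : ℝ :=
  1 / 2 * (x / 2) ^ ν * besselIntegral ν (x ^ 2 / 4)

lemma macdonald_nonneg (ν : ℝ) {x : ℝ} (hx : 0 < x) : 0 ≤ macdonald ν x := by
  refine mul_nonneg (by positivity) (setIntegral_nonneg measurableSet_Ioi fun u hu => ?_)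
  have hu : 0 < u := hu
  positivity

lemma eq_macdonald_of_tendsto {ν x k : ℝ} (hν : -1 / 2 < ν) (hx : 0 < x)
    (h : Tendsto (fun T => ∫ t in (0 : ℝ)..T, Real.cos t / (x ^ 2 + t ^ 2) ^ (ν + 1 / 2)) atTop
      (nhds (Real.sqrt Real.pi * k / ((2 : ℝ) ^ ν * Real.Gamma (ν + 1 / 2) * x ^ ν)))) :
    k = macdonald ν x := by
  have e := tendsto_nhds_unique h (tendsto_integral_cos_div_rpow hν hx)
  have hG := Real.Gamma_pos_of_pos (show 0 < ν + 1 / 2 by linarith)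
  have hπ : 0 < Real.sqrt Real.pi := Real.sqrt_pos.mpr Real.pi_pos
  have h4 : (4 : ℝ) ^ (-ν) = ((2 : ℝ) ^ ν * 2 ^ ν)⁻¹ := by
    rw [← Real.mul_rpow (by norm_num) (by norm_num), ← Real.rpow_neg (by norm_num)]
    norm_num
  have h2 : (0 : ℝ) < 2 ^ ν := by positivity
  have hx' : 0 < x ^ ν := by positivity
  rw [h4] at e
  rw [macdonald, Real.div_rpow hx.le (by norm_num)]
  generalize Real.Gamma (ν + 1 / 2) = G at e hG
  field_simp at e ⊢
  linear_combination e

lemma integral_rpow_mul_macdonald {lam s b : ℝ} (hb : 0 < b) (hs : |lam| < s) :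
    IntegrableOn (fun x => x ^ (s - 1) * macdonald lam (b * x)) (Ioi 0) ∧
    ∫ x in Ioi (0 : ℝ), x ^ (s - 1) * macdonald lam (b * x) =
      2 ^ (s - 2) * b ^ (-s) * Real.Gamma ((s + lam) / 2) * Real.Gamma ((s - lam) / 2) := by
  obtain ⟨hs1, hs2⟩ := abs_lt.mp hs
  have hp : 0 < (s + lam) / 2 := by linarith
  have hq : 0 < (s - lam) / 2 := by linarith
  set f : ℝ → ℝ → ℝ := fun u x => u ^ (lam - 1) * Real.exp (-u⁻¹) *
    (x ^ (s + lam - 1) * Real.exp (-(b ^ 2 / 4 * u) * x ^ (2 : ℝ))) with hf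
  have hf0 : ∀ u x : ℝ, 0 < u → 0 < x → 0 ≤ f u x := by
    intro u x hu hx
    simp only [hf]
    positivity
  have inner : ∀ u : ℝ, 0 < u → ∫ x in Ioi (0 : ℝ), f u x =
      1 / 2 * (b ^ 2 / 4) ^ (-((s + lam) / 2)) * Real.Gamma ((s + lam) / 2) *
        (u ^ (-((s - lam) / 2) - 1) * Real.exp (-u⁻¹)) := by
    intro u hu
    simp only [hf]
    rw [integral_const_mul, integral_rpow_mul_exp_neg_mul_rpow (by norm_num) (by linarith)
      (by positivity), sub_add_cancel, Real.mul_rpow (by positivity) hu.le, neg_div,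
      show -((s - lam) / 2) - 1 = lam - 1 + -((s + lam) / 2) by ring, Real.rpow_add hu]
    ring
  have hint : Integrable (Function.uncurry f)
      ((volume.restrict (Ioi 0)).prod (volume.restrict (Ioi 0))) := by
    have hm : Measurable (Function.uncurry f) := by
      simp only [hf]
      unfold Function.uncurry
      fun_prop
    rw [integrable_prod_iff hm.aestronglyMeasurable]
    constructor
    · refine (ae_restrict_mem measurableSet_Ioi).mono fun u hu => ?_
      have hu : 0 < u := hu
      have hu' : 0 < b ^ 2 / 4 * u := by positivity
      exact (integrableOn_rpow_mul_exp_neg_mul_rpow (p := 2) (s := s + lam - 1) (by linarith)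
        two_pos hu').const_mul (u ^ (lam - 1) * Real.exp (-u⁻¹))
    · refine ((integrableOn_rpow_mul_exp_neg_inv hq).const_mul (1 / 2 *
        (b ^ 2 / 4) ^ (-((s + lam) / 2)) * Real.Gamma ((s + lam) / 2))).congr ?_
      refine (ae_restrict_mem measurableSet_Ioi).mono fun u hu => ?_
      simp only
      rw [← inner u hu]
      refine setIntegral_congr_fun measurableSet_Ioi fun x hx => ?_
      exact (Real.norm_of_nonneg (hf0 u x hu hx)).symm
  have hmac : ∀ x : ℝ, 0 < x → x ^ (s - 1) * macdonald lam (b * x) =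
      1 / 2 * (b / 2) ^ lam * ∫ u in Ioi (0 : ℝ), f u x := by
    intro x hx
    have e : ∫ u in Ioi (0 : ℝ), f u x =
        x ^ (s + lam - 1) * besselIntegral lam ((b * x) ^ 2 / 4) := by
      rw [besselIntegral, ← integral_const_mul]
      refine integral_congr_ae (Eventually.of_forall fun u => ?_)
      simp only [hf]
      rw [show -((b * x) ^ 2 / 4 * u) - u⁻¹ = -u⁻¹ + -(b ^ 2 / 4 * u) * x ^ (2 : ℝ) by
        rw [Real.rpow_two]; ring, Real.exp_add]
      ring
    rw [e, macdonald, mul_div_right_comm, Real.mul_rpow (by positivity) hx.le,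
      show s + lam - 1 = s - 1 + lam by ring, Real.rpow_add hx]
    ring
  constructor
  · refine (hint.integral_prod_right.const_mul (1 / 2 * (b / 2) ^ lam)).congr ?_
    refine (ae_restrict_mem measurableSet_Ioi).mono fun x hx => ?_
    exact (hmac x hx).symm
  · rw [setIntegral_congr_fun measurableSet_Ioi fun x hx => hmac x hx, integral_const_mul,
      ← integral_integral_swap hint, setIntegral_congr_fun measurableSet_Ioi inner,
      integral_const_mul, integral_rpow_mul_exp_neg_inv hq]
    have e1 : (b ^ 2 / 4) ^ (-((s + lam) / 2)) = (b / 2) ^ (-(s + lam)) := by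
      rw [show b ^ 2 / 4 = (b / 2) ^ (2 : ℝ) by rw [Real.rpow_two]; ring,
        ← Real.rpow_mul (by positivity)]
      ring_nf
    have e2 : (b / 2) ^ lam * (b / 2) ^ (-(s + lam)) = b ^ (-s) * 2 ^ s := by
      rw [← Real.rpow_add (by positivity), show lam + -(s + lam) = -s by ring,
        Real.div_rpow hb.le (by norm_num), Real.rpow_neg (by norm_num : (0 : ℝ) ≤ 2),
        div_inv_eq_mul]
    have e3 : (2 : ℝ) ^ s = 2 ^ (s - 2) * 4 := by
      rw [Real.rpow_sub (by norm_num), Real.rpow_two]; ring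
    rw [e1]
    linear_combination (1 / 4 * Real.Gamma ((s + lam) / 2) * Real.Gamma ((s - lam) / 2)) *
      (e2 + b ^ (-s) * e3)

lemma poch_succ (q : ℝ) (n : ℕ) : poch q (n + 1) = poch q n * (q + n) :=
  Finset.prod_range_succ _ _

lemma poch_pos {q : ℝ} (hq : 0 < q) (n : ℕ) : 0 < poch q n :=
  Finset.prod_pos fun i _ => by positivity

lemma gamma_add_natCast {q : ℝ} (hq : 0 < q) (n : ℕ) :
    Real.Gamma (q + n) = poch q n * Real.Gamma q := by
  induction n with
  | zero => simp [poch]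
  | succ n ih => rw [gamma_add_natCast_succ hq, ih, poch_succ]; ring

lemma summable_hypergeometric {p q c w : ℝ} (hp : 0 < p) (hq : 0 < q) (hc : 0 < c)
    (hw0 : 0 < w) (hw1 : w < 1) :
    Summable fun n : ℕ => poch p n * poch q n / (poch c n * (n.factorial : ℝ)) * w ^ n := by
  have hpos : ∀ n : ℕ, 0 < poch p n * poch q n / (poch c n * (n.factorial : ℝ)) * w ^ n := by
    intro n
    have := poch_pos hp n
    have := poch_pos hq n
    have := poch_pos hc n
    positivity
  refine summable_of_ratio_test_tendsto_lt_one hw1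
    (Eventually.of_forall fun n => (hpos n).ne') ?_
  have l : ∀ d : ℝ, Tendsto (fun n : ℕ => (d + n) / (n : ℝ)) atTop (nhds 1) := by
    intro d
    have h := (tendsto_const_div_atTop_nhds_zero_nat d).add_const 1
    rw [zero_add] at h
    refine h.congr' ?_
    filter_upwards [eventually_gt_atTop 0] with n hn
    field_simp
  have h := (((l p).mul (l q)).div ((l c).mul (l 1)) (by norm_num)).mul_const w
  simp only [mul_one, div_one, one_mul] at h
  refine h.congr' ?_
  filter_upwards [eventually_gt_atTop 0] with n hn
  have := poch_pos hp n
  have := poch_pos hq n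
  have := poch_pos hc n
  rw [Real.norm_of_nonneg (hpos _).le, Real.norm_of_nonneg (hpos _).le, poch_succ, poch_succ,
    poch_succ, Nat.factorial_succ]
  have : 0 < c + n := by positivity
  simp only [Pi.div_apply]
  push_cast
  field_simp
  ring

lemma integral_rpow_mul_besselSeries_mul_macdonald {μ lam s a b : ℝ} (hμ : -1 < μ) (ha : 0 < a)
    (hab : a < b) (hs : |lam| < s) :
    IntegrableOn (fun x => x ^ (s - 1) * besselSeries μ ((a * x) ^ 2 / 4) * macdonald lam (b * x))
      (Ioi 0) ∧
    ∫ x in Ioi (0 : ℝ), x ^ (s - 1) * besselSeries μ ((a * x) ^ 2 / 4) * macdonald lam (b * x) =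
      2 ^ (s - 2) * b ^ (-s) * Real.Gamma ((s + lam) / 2) * Real.Gamma ((s - lam) / 2) /
        Real.Gamma (1 + μ) *
        ∑' n : ℕ, poch ((s + lam) / 2) n * poch ((s - lam) / 2) n /
          (poch (1 + μ) n * (n.factorial : ℝ)) * (a ^ 2 / b ^ 2) ^ n := by
  obtain ⟨hs1, hs2⟩ := abs_lt.mp hs
  have hb : 0 < b := ha.trans hab
  have hp : 0 < (s + lam) / 2 := by linarith
  have hq : 0 < (s - lam) / 2 := by linarith
  have hc : 0 < 1 + μ := by linarith
  have hGc := Real.Gamma_pos_of_pos hc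
  have hGp := Real.Gamma_pos_of_pos hp
  have hGq := Real.Gamma_pos_of_pos hq
  set C : ℝ := 2 ^ (s - 2) * b ^ (-s) * Real.Gamma ((s + lam) / 2) *
    Real.Gamma ((s - lam) / 2) / Real.Gamma (1 + μ) with hC
  have hC0 : 0 < C := by positivity
  set H : ℕ → ℝ := fun n => poch ((s + lam) / 2) n * poch ((s - lam) / 2) n /
    (poch (1 + μ) n * (n.factorial : ℝ)) * (a ^ 2 / b ^ 2) ^ n with hH
  have hHs : Summable H := summable_hypergeometric hp hq hc (by positivity)
    ((div_lt_one (by positivity)).mpr (by gcongr))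
  have hH0 : ∀ n, 0 < H n := by
    intro n
    have := poch_pos hp n
    have := poch_pos hq n
    have := poch_pos hc n
    simp only [hH]
    positivity
  set F : ℕ → ℝ → ℝ := fun n x => (a ^ 2 / 4) ^ n / (Real.Gamma (1 + μ + n) * n.factorial) *
    (x ^ (s + 2 * n - 1) * macdonald lam (b * x)) with hF
  have hm : ∀ n : ℕ, |lam| < s + 2 * n := fun n =>
    hs.trans_le (le_add_of_nonneg_right (by positivity))
  have hFint : ∀ n, IntegrableOn (F n) (Ioi 0) := fun n =>
    (integral_rpow_mul_macdonald hb (hm n)).1.const_mul _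
  have hFval : ∀ n, ∫ x in Ioi (0 : ℝ), F n x = C * H n := by
    intro n
    have hpc := poch_pos hc n
    simp only [hF]
    rw [integral_const_mul, (integral_rpow_mul_macdonald hb (hm n)).2,
      show (s + 2 * n + lam) / 2 = (s + lam) / 2 + n by ring,
      show (s + 2 * n - lam) / 2 = (s - lam) / 2 + n by ring,
      gamma_add_natCast hp, gamma_add_natCast hq, gamma_add_natCast hc,
      show s + 2 * n - 2 = s - 2 + (2 * n : ℕ) by push_cast; ring,
      show -(s + 2 * n) = -s - (2 * n : ℕ) by push_cast; ring,
      Real.rpow_add_natCast (by norm_num), Real.rpow_sub_natCast hb.ne', pow_mul, pow_mul]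
    simp only [hC, hH, div_pow]
    norm_num
    field_simp
  have hF0 : ∀ n, ∀ x ∈ Ioi (0 : ℝ), ‖F n x‖ = F n x := by
    intro n x hx
    have hx : 0 < x := hx
    have := macdonald_nonneg lam (mul_pos hb hx)
    have : 0 < Real.Gamma (1 + μ + n) := Real.Gamma_pos_of_pos (by positivity)
    exact Real.norm_of_nonneg (by simp only [hF]; positivity)
  have hsum := hasSum_integral_of_summable_integral_norm hFint (by
    simp only [setIntegral_congr_fun measurableSet_Ioi (hF0 _), hFval]
    exact hHs.mul_left C)
  simp only [hFval] at hsum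
  have hpt : ∀ x ∈ Ioi (0 : ℝ), ∑' n, F n x =
      x ^ (s - 1) * besselSeries μ ((a * x) ^ 2 / 4) * macdonald lam (b * x) := by
    intro x hx
    have hx : 0 < x := hx
    rw [besselSeries, ← tsum_mul_left, ← tsum_mul_right]
    refine tsum_congr fun n => ?_
    simp only [hF]
    rw [show s + 2 * n - 1 = s - 1 + (2 * n : ℕ) by push_cast; ring,
      Real.rpow_add_natCast hx.ne', pow_mul, show (a * x) ^ 2 / 4 = a ^ 2 / 4 * x ^ 2 by ring,
      mul_pow]
    ring
  rw [setIntegral_congr_fun measurableSet_Ioi hpt] at hsum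
  have hval := hsum.unique (hHs.hasSum.mul_left C)
  refine ⟨?_, hval⟩
  by_contra hni
  have h0 := integral_undef hni
  rw [hval] at h0
  exact (mul_pos hC0 (hHs.tsum_pos (fun n => (hH0 n).le) 0 (hH0 0))).ne' h0

theorem stmt_16 (K : ℝ → ℝ → ℝ)
    (hK : ∀ ν : ℝ, -1/2 < ν → ∀ x : ℝ, 0 < x →
      Tendsto (fun T => ∫ t in (0:ℝ)..T, Real.cos t / (x ^ 2 + t ^ 2) ^ (ν + 1/2))
        atTop
        (nhds (Real.sqrt Real.pi * K ν x /
          ((2 : ℝ) ^ ν * Real.Gamma (ν + 1/2) * x ^ ν))))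
    (a b ν lam ρ : ℝ) (ha : 0 < a) (hab : a < b)
    (hν0 : 0 < ν) (hν : ν < 1/2) (hlam1 : -1/2 < lam) (hlam2 : lam < 1/2)
    (hρ : ν + |lam| < ρ) :
    ∫ x in Ioi (0:ℝ), x ^ (ρ - 1) * K ν (a * x) * K lam (b * x) =
      (2 : ℝ) ^ (ρ - 3) * b ^ (ν - ρ) * a ^ (-ν) * Real.Gamma ν *
        Real.Gamma ((ρ - ν + lam) / 2) * Real.Gamma ((ρ - ν - lam) / 2) *
        (∑' n : ℕ, (poch ((ρ - ν + lam) / 2) n * poch ((ρ - ν - lam) / 2) n /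
          (poch (1 - ν) n * (n.factorial : ℝ))) * (a ^ 2 / b ^ 2) ^ n)
      + (2 : ℝ) ^ (ρ - 3) * a ^ ν * b ^ (-ν - ρ) * Real.Gamma (-ν) *
        Real.Gamma ((ρ + ν + lam) / 2) * Real.Gamma ((ρ + ν - lam) / 2) *
        (∑' n : ℕ, (poch ((ρ + ν + lam) / 2) n * poch ((ρ + ν - lam) / 2) n /
          (poch (1 + ν) n * (n.factorial : ℝ))) * (a ^ 2 / b ^ 2) ^ n) := by
  have hb : 0 < b := ha.trans hab
  have hG1 := Real.Gamma_pos_of_pos (show 0 < 1 + ν by linarith)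
  have hG2 := Real.Gamma_pos_of_pos (show 0 < 1 + -ν by linarith)
  have gν : Real.Gamma (1 + ν) = ν * Real.Gamma ν := by
    rw [add_comm, Real.Gamma_add_one hν0.ne']
  have gν' : Real.Gamma (1 + -ν) = -ν * Real.Gamma (-ν) := by
    rw [add_comm, Real.Gamma_add_one (by linarith)]
  obtain ⟨i₁, v₁⟩ := integral_rpow_mul_besselSeries_mul_macdonald (μ := -ν) (s := ρ - ν)
    (lam := lam) (by linarith) ha hab (by linarith)
  obtain ⟨i₂, v₂⟩ := integral_rpow_mul_besselSeries_mul_macdonald (μ := ν) (s := ρ + ν)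
    (lam := lam) (by linarith) ha hab (by linarith)
  set A : ℝ := 1 / 2 * (a / 2) ^ (-ν) * (Real.Gamma ν * Real.Gamma (1 + -ν)) with hA
  set B : ℝ := 1 / 2 * (a / 2) ^ ν * (Real.Gamma (-ν) * Real.Gamma (1 + ν)) with hB
  have hpt : ∀ x ∈ Ioi (0 : ℝ), x ^ (ρ - 1) * K ν (a * x) * K lam (b * x) =
      A * (x ^ (ρ - ν - 1) * besselSeries (-ν) ((a * x) ^ 2 / 4) * macdonald lam (b * x)) +
      B * (x ^ (ρ + ν - 1) * besselSeries ν ((a * x) ^ 2 / 4) * macdonald lam (b * x)) := by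
    intro x hx
    have hx : 0 < x := hx
    rw [eq_macdonald_of_tendsto (by linarith) (mul_pos ha hx) (hK ν (by linarith) _ (mul_pos ha hx)),
      eq_macdonald_of_tendsto hlam1 (mul_pos hb hx) (hK lam hlam1 _ (mul_pos hb hx)),
      macdonald, besselIntegral_eq_besselSeries hν0 (by linarith) (by positivity),
      show ρ - ν - 1 = ρ - 1 + -ν by ring, show ρ + ν - 1 = ρ - 1 + ν by ring,
      Real.rpow_add hx, Real.rpow_add hx, hA, hB, mul_div_right_comm a x 2,
      Real.mul_rpow (by positivity) hx.le]
    have e1 : ((a * x) ^ 2 / 4) ^ (-ν) =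
        (a / 2) ^ (-ν) * (a / 2) ^ (-ν) * (x ^ (-ν) * x ^ (-ν)) := by
      rw [show (a * x) ^ 2 / 4 = (a / 2) * (a / 2) * (x * x) by ring,
        Real.mul_rpow (by positivity) (by positivity), Real.mul_rpow hx.le hx.le,
        Real.mul_rpow (by positivity) (by positivity)]
    have e2 : (a / 2) ^ (-ν) * (a / 2) ^ ν = 1 := by
      rw [← Real.rpow_add (by positivity)]; simp
    have e3 : x ^ (-ν) * x ^ ν = 1 := by
      rw [← Real.rpow_add hx]; simp
    have c1 : Real.Gamma (1 + ν) * Real.Gamma (1 - ν) / ν =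
        Real.Gamma ν * Real.Gamma (1 + -ν) := by
      rw [gν, ← sub_eq_add_neg]
      field_simp
    have c2 : Real.Gamma (-ν) * Real.Gamma (1 + ν) =
        -(Real.Gamma ν * Real.Gamma (1 + -ν)) := by
      rw [gν, gν']
      ring
    rw [c1, c2, e1]
    linear_combination (x ^ (ρ - 1) / 2 * (Real.Gamma ν * Real.Gamma (1 + -ν)) *
      macdonald lam (b * x) * besselSeries (-ν) ((a * x) ^ 2 / 4) *
      ((a / 2) ^ (-ν) * x ^ (-ν))) * (x ^ (-ν) * x ^ ν * e2 + e3)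
  rw [setIntegral_congr_fun measurableSet_Ioi hpt,
    integral_add (i₁.const_mul A) (i₂.const_mul B), integral_const_mul, integral_const_mul, v₁, v₂]
  have e4 : 1 / 2 * (a / 2) ^ (-ν) * 2 ^ (ρ - ν - 2) = 2 ^ (ρ - 3) * a ^ (-ν) := by
    rw [Real.div_rpow ha.le (by norm_num), show ρ - ν - 2 = ρ - 3 + -ν + 1 by ring,
      Real.rpow_add_one (by norm_num), Real.rpow_add (by norm_num)]
    have : (0 : ℝ) < 2 ^ (-ν) := by positivity
    field_simp
  have e5 : 1 / 2 * (a / 2) ^ ν * 2 ^ (ρ + ν - 2) = 2 ^ (ρ - 3) * a ^ ν := by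
    rw [Real.div_rpow ha.le (by norm_num), show ρ + ν - 2 = ρ - 3 + ν + 1 by ring,
      Real.rpow_add_one (by norm_num), Real.rpow_add (by norm_num)]
    have : (0 : ℝ) < 2 ^ ν := by positivity
    field_simp
  have assemble : ∀ {α c t β P Q G g S : ℝ}, G ≠ 0 → 1 / 2 * α * t = c →
      1 / 2 * α * (g * G) * (t * β * P * Q / G * S) = c * β * g * P * Q * S := by
    intro α c t β P Q G g S hG h
    rw [← h]
    field_simp
  rw [hA, hB, assemble hG2.ne' e4, assemble hG1.ne' e5, show ν - ρ = -(ρ - ν) by ring,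
    show -ν - ρ = -(ρ + ν) by ring, ← sub_eq_add_neg 1 ν]
  ring
end
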